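/- arXiv:2504.20709 — 4 statements merged into one kernel-verified Lean document; each statement's English description precedes it below -/
import Mathlib

section
/- Let d be a positive integer and let c : ℝ^d → ℂ be an integral ℝ^d-configuration (finite range, all values integers) that is annihilated by some non-trivial integral ℝ^d-polynomial f. Then for every u in the support of f there exist a finite (possibly empty) list of vectors v_1, …, v_m ∈ ℝ^d, pairwise linearly independent over ℚ, such that for each i there are u_i ∈ supp(f) \ {u} and a nonzero rational q_i with v_i = q_i·(u_i − u), and c is annihilated by the product of difference ℝ^d-polynomials (X^{v_1}−1)⋯(X^{v_m}−1), i.e., Δ_{v_1}∘⋯∘Δ_{v_m}(c) = 0 (where the empty composition is the identity, so m = 0 asserts c = 0). -/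
/- STATEMENT 0: Special annihilator theorem for integral ℝ^d-configurations
   (product of difference ℝ^d-polynomials in directions parallel over ℚ to
   u_i − u, pairwise linearly independent over ℚ). -/

noncomputable section

abbrev Euc (d : ℕ) := EuclideanSpace ℝ (Fin d)

/-- Convolution of a finitely supported `f` with `c`. -/
def conv {d : ℕ} (f c : Euc d → ℂ) (u : Euc d) : ℂ := ∑ᶠ v, f v * c (u - v)

/-- `f` annihilates `c`. -/
def Annihilates {d : ℕ} (f c : Euc d → ℂ) : Prop := ∀ u, conv f c u = 0

/-- The difference operator Δ_v, i.e. multiplication by `X^v − 1`. -/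
def Delta {d : ℕ} (v : Euc d) (c : Euc d → ℂ) : Euc d → ℂ := fun u => c (u - v) - c u

section helpers
variable {G : Type*} [AddCommGroup G]

open AddMonoidAlgebra in
def shiftHom (G : Type*) [AddCommGroup G] :
    Multiplicative G →* Module.End ℤ (G → ℤ) where
  toFun v :=
    { toFun := fun c u => c (u - v.toAdd)
      map_add' := fun _ _ => rfl
      map_smul' := fun _ _ => rfl }
  map_one' := by ext c u; simp
  map_mul' v w := by
    ext c u
    simp only [toAdd_mul, LinearMap.coe_mk, AddHom.coe_mk, Module.End.mul_apply]
    congr 1; abel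

def act (G : Type*) [AddCommGroup G] :
    AddMonoidAlgebra ℤ G →ₐ[ℤ] Module.End ℤ (G → ℤ) :=
  AddMonoidAlgebra.lift ℤ (Module.End ℤ (G → ℤ)) G (shiftHom G)

lemma act_single (v : G) (a : ℤ) (c : G → ℤ) (u : G) :
    act G (AddMonoidAlgebra.single v a) c u = a * c (u - v) := by
  simp [act, AddMonoidAlgebra.lift_single, shiftHom]

def fk {ι : Type*} (S : Finset ι) (a : ι → ℤ) (g : ι → G) (k : ℕ) : AddMonoidAlgebra ℤ G :=
  ∑ w ∈ S, AddMonoidAlgebra.single (k • g w) (a w)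

lemma act_fk {ι : Type*} (S : Finset ι) (a : ι → ℤ) (g : ι → G) (k : ℕ) (c : G → ℤ) (u : G) :
    act G (fk S a g k) c u = ∑ w ∈ S, a w * c (u - k • g w) := by
  simp [fk, map_sum, LinearMap.sum_apply, Finset.sum_apply, act_single]

lemma sum_pow_prime {R ι : Type*} [CommRing R] {p : ℕ} (hp : p.Prime) (S : Finset ι) (x : ι → R) :
    ∃ r, (∑ i ∈ S, x i) ^ p = ∑ i ∈ S, x i ^ p + p * r := by
  classical
  induction S using Finset.induction_on with
  | empty => exact ⟨0, by simp [hp.ne_zero]⟩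
  | insert i S hi ih =>
    obtain ⟨r, hr⟩ := ih
    obtain ⟨r', hr'⟩ := exists_add_pow_prime_eq hp (x i) (∑ i ∈ S, x i)
    refine ⟨r + (x i * ∑ i ∈ S, x i) * r', ?_⟩
    rw [Finset.sum_insert hi, Finset.sum_insert hi, hr', hr]
    ring

lemma fk_pow {ι : Type*} (S : Finset ι) (a : ι → ℤ) (g : ι → G) (k p : ℕ) (hp : p.Prime) :
    ∃ r, fk S a g (p * k) = fk S a g k ^ p + p * r := by
  obtain ⟨r, hr⟩ := sum_pow_prime hp S (fun w => (AddMonoidAlgebra.single (k • g w) (a w)))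
  have h : ∀ w, ∃ b : ℤ, a w = a w ^ p + p * b := by
    intro w
    have := Fact.mk hp
    have : ((a w - a w ^ p : ℤ) : ZMod p) = 0 := by push_cast; rw [ZMod.pow_card]; ring
    obtain ⟨b, hb⟩ := (ZMod.intCast_zmod_eq_zero_iff_dvd _ _).1 this
    exact ⟨b, by linarith⟩
  choose b hb using h
  refine ⟨∑ w ∈ S, AddMonoidAlgebra.single ((p * k) • g w) (b w) - r, ?_⟩
  have e : fk S a g (p * k) = ∑ w ∈ S, (AddMonoidAlgebra.single (k • g w) (a w)) ^ p
      + p * ∑ w ∈ S, AddMonoidAlgebra.single ((p * k) • g w) (b w) := by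
    rw [fk, Finset.mul_sum, ← Finset.sum_add_distrib]
    refine Finset.sum_congr rfl fun w _ => ?_
    rw [AddMonoidAlgebra.single_pow, ← nsmul_eq_mul, AddMonoidAlgebra.smul_single, smul_smul,
      ← AddMonoidAlgebra.single_add, nsmul_eq_mul, ← hb w]
  rw [e]
  unfold fk
  rw [hr]; ring

lemma prime_step {ι : Type*} (S : Finset ι) (a : ι → ℤ) (g : ι → G) (c : G → ℤ) (M : ℤ)
    (hM : ∀ u, |c u| ≤ M) (k p : ℕ) (hp : p.Prime) (hB : (∑ w ∈ S, |a w|) * M < p)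
    (h : act G (fk S a g k) c = 0) : act G (fk S a g (p * k)) c = 0 := by
  obtain ⟨r, hr⟩ := fk_pow S a g k p hp
  obtain ⟨n, rfl⟩ : ∃ n, p = n + 1 := ⟨p - 1, by have := hp.pos; omega⟩
  funext u
  have h1 : ((n + 1 : ℕ) : ℤ) ∣ act G (fk S a g ((n + 1) * k)) c u := by
    refine ⟨act G r c u, ?_⟩
    rw [hr, map_add, pow_succ, map_mul, ← nsmul_eq_mul, map_nsmul]
    simp [h, Module.End.mul_apply]
    ring
  refine Int.eq_zero_of_abs_lt_dvd h1 (lt_of_le_of_lt ?_ hB)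
  rw [act_fk, Finset.sum_mul]
  refine (Finset.abs_sum_le_sum_abs _ _).trans (Finset.sum_le_sum fun w _ => ?_)
  rw [abs_mul]
  exact mul_le_mul_of_nonneg_left (hM _) (abs_nonneg _)

lemma all_step {ι : Type*} (S : Finset ι) (a : ι → ℤ) (g : ι → G) (c : G → ℤ) (M : ℤ)
    (hM : ∀ u, |c u| ≤ M) (h : act G (fk S a g 1) c = 0) (k : ℕ) (hk : k ≠ 0)
    (hp : ∀ p : ℕ, p.Prime → p ∣ k → (∑ w ∈ S, |a w|) * M < p) :
    act G (fk S a g k) c = 0 := by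
  induction k using induction_on_primes with
  | zero => exact absurd rfl hk
  | one => exact h
  | prime_mul p k hpp ih =>
    refine prime_step S a g c M hM k p hpp (hp p hpp (dvd_mul_right _ _)) (ih ?_ ?_)
    · rintro rfl; simp at hk
    · intro q hq hqk
      exact hp q hq (hqk.mul_left _)

lemma prod_ann {ι : Type*} [DecidableEq ι] (S : Finset ι) (a : ι → ℤ) (g : ι → G) (c : G → ℤ)
    (M : ℤ) (hM : ∀ u, |c u| ≤ M) (h : act G (fk S a g 1) c = 0) (i0 : ι) (hi0 : i0 ∈ S)
    (ha : a i0 ≠ 0) (hg : g i0 = 0) :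
    ∃ r : ℕ, r ≠ 0 ∧
      act G (∏ w ∈ S.erase i0, (AddMonoidAlgebra.single (r • g w) (1 : ℤ) - 1)) c = 0 := by
  set B := ((∑ w ∈ S, |a w|) * M).toNat with hB
  refine ⟨B.factorial, B.factorial_ne_zero, ?_⟩
  set r := B.factorial with hr
  have hk : ∀ i : ℕ, act G (fk S a g (1 + i * r)) c = 0 := by
    intro i
    refine all_step S a g c M hM h _ (by omega) fun p hp hd => ?_
    by_contra hlt
    have hle : p ≤ B := by omega
    have h1 : p ∣ r := hp.dvd_factorial.2 hle
    have h2 : p ∣ 1 := (Nat.dvd_add_left (h1.mul_left i)).1 hd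
    exact hp.one_lt.ne' (Nat.dvd_one.1 h2)
  set t : ι → AddMonoidAlgebra ℤ G := fun w => AddMonoidAlgebra.single (r • g w) (1 : ℤ) with ht
  set P : Polynomial (AddMonoidAlgebra ℤ G) :=
    ∏ w ∈ S.erase i0, (Polynomial.X - Polynomial.C (t w)) with hP
  have hs : ∀ i w, AddMonoidAlgebra.single ((1 + i * r) • g w) (a w)
      = AddMonoidAlgebra.single (g w) (a w) * t w ^ i := by
    intro i w
    rw [ht]
    simp only [AddMonoidAlgebra.single_pow, AddMonoidAlgebra.single_mul_single, one_pow, mul_one]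
    rw [add_smul, one_smul, mul_smul]
  have e : ∑ i ∈ Finset.range (P.natDegree + 1), P.coeff i * fk S a g (1 + i * r)
      = ∑ w ∈ S, AddMonoidAlgebra.single (g w) (a w) * P.eval (t w) := by
    simp only [fk, Finset.mul_sum, Polynomial.eval_eq_sum_range]
    rw [Finset.sum_comm]
    refine Finset.sum_congr rfl fun w _ => Finset.sum_congr rfl fun i _ => ?_
    rw [hs]; ring
  have e2 : ∑ w ∈ S, AddMonoidAlgebra.single (g w) (a w) * P.eval (t w)
      = a i0 • ∏ w ∈ S.erase i0, (1 - t w) := by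
    rw [Finset.sum_eq_single_of_mem i0 hi0]
    · have : t i0 = 1 := by simp [ht, hg, AddMonoidAlgebra.one_def]
      rw [this, hg, hP, Polynomial.eval_prod]
      simp only [Polynomial.eval_sub, Polynomial.eval_X, Polynomial.eval_C]
      have h3 : (AddMonoidAlgebra.single (0 : G) (a i0)) = a i0 • (1 : AddMonoidAlgebra ℤ G) := by
        rw [AddMonoidAlgebra.one_def, AddMonoidAlgebra.smul_single]; simp
      rw [h3, smul_mul_assoc, one_mul]
    · intro w hw hne
      have : P.eval (t w) = 0 := by
        rw [hP, Polynomial.eval_prod]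
        exact Finset.prod_eq_zero (Finset.mem_erase.2 ⟨hne, hw⟩) (by simp)
      rw [this, mul_zero]
  have e3 : act G (a i0 • ∏ w ∈ S.erase i0, (1 - t w)) c = 0 := by
    rw [← e2, ← e, map_sum, LinearMap.sum_apply]
    refine Finset.sum_eq_zero fun i _ => ?_
    rw [map_mul, Module.End.mul_apply, hk, map_zero]
  rw [map_zsmul, LinearMap.smul_apply, smul_eq_zero_iff_right ha] at e3
  have e4 : ∏ w ∈ S.erase i0, (t w - 1) =
      (-1) ^ (S.erase i0).card * ∏ w ∈ S.erase i0, (1 - t w) := by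
    rw [← Finset.prod_const, ← Finset.prod_mul_distrib]
    exact Finset.prod_congr rfl fun w _ => by ring
  rw [e4, map_mul, Module.End.mul_apply, e3, map_zero]

end helpers

section deltas
variable {d : ℕ}

lemma Delta_comm (v w : Euc d) (c : Euc d → ℂ) : Delta v (Delta w c) = Delta w (Delta v c) := by
  funext u
  simp only [Delta]
  rw [sub_right_comm u v w]; ring

lemma foldr_Delta_comm (L : List (Euc d)) (v : Euc d) (c : Euc d → ℂ) :
    L.foldr Delta (Delta v c) = Delta v (L.foldr Delta c) := by
  induction L with
  | nil => rfl
  | cons w L ih => rw [List.foldr_cons, List.foldr_cons, ih, Delta_comm]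

lemma foldr_perm {L L' : List (Euc d)} (h : L.Perm L') (c : Euc d → ℂ) :
    L.foldr Delta c = L'.foldr Delta c := by
  induction h with
  | nil => rfl
  | cons x _ ih => simp [ih]
  | swap x y l => simp [Delta_comm]
  | trans _ _ h1 h2 => rw [h1, h2]

lemma Delta_zsmul {v : Euc d} {c : Euc d → ℂ} (h : Delta v c = 0) (n : ℤ) :
    Delta (n • v) c = 0 := by
  have hp : Function.Periodic c v := by
    intro x
    have := congrFun h (x + v)
    simp only [Delta, add_sub_cancel_right, Pi.zero_apply] at this
    exact (sub_eq_zero.1 this).symm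
  funext u
  simp [Delta, (hp.zsmul n).sub_eq u]

def Bdd (c : Euc d → ℂ) : Prop := ∃ M : ℝ, ∀ u, ‖c u‖ ≤ M

lemma Bdd.delta {c : Euc d → ℂ} (h : Bdd c) (v : Euc d) : Bdd (Delta v c) := by
  obtain ⟨M, hM⟩ := h
  exact ⟨M + M, fun u => (norm_sub_le _ _).trans (add_le_add (hM _) (hM _))⟩

lemma Bdd.foldr {c : Euc d → ℂ} (h : Bdd c) (L : List (Euc d)) : Bdd (L.foldr Delta c) := by
  induction L with
  | nil => exact h
  | cons v L ih => exact ih.delta v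

lemma Delta_sq {c : Euc d → ℂ} (hc : Bdd c) (v : Euc d) (h : Delta v (Delta v c) = 0) :
    Delta v c = 0 := by
  obtain ⟨M, hM⟩ := hc
  funext u
  have h1 : ∀ n : ℕ, Delta v c (u - n • v) = Delta v c u := by
    intro n
    have := congrFun (Delta_zsmul h n) u
    simp only [Delta, Pi.zero_apply, natCast_zsmul] at this ⊢
    exact sub_eq_zero.1 this
  have h2 : ∀ n : ℕ, c (u - n • v) = c u + n * Delta v c u := by
    intro n
    induction n with
    | zero => simp
    | succ n ih =>
      have := h1 n
      have h3 : Delta v c (u - n • v) = c (u - (n + 1) • v) - c (u - n • v) := by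
        simp only [Delta]; congr 2; rw [add_smul, one_smul]; abel
      push_cast
      linear_combination ih + this - h3
  by_contra hne
  have hpos : 0 < ‖Delta v c u‖ := norm_pos_iff.2 hne
  obtain ⟨n, hn⟩ := exists_nat_gt ((M + M) / ‖Delta v c u‖)
  rw [div_lt_iff₀ hpos] at hn
  have h4 : ‖(n : ℂ) * Delta v c u‖ ≤ M + M := by
    have : (n : ℂ) * Delta v c u = c (u - n • v) - c u := by rw [h2]; ring
    rw [this]
    exact (norm_sub_le _ _).trans (add_le_add (hM _) (hM _))
  rw [norm_mul, Complex.norm_natCast] at h4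
  linarith

def Ind (v w : Euc d) : Prop := ∀ a b : ℚ, (a : ℝ) • v + (b : ℝ) • w = 0 → a = 0 ∧ b = 0

lemma Ind.symm {v w : Euc d} (h : Ind v w) : Ind w v := fun a b e =>
  (h b a (by rw [add_comm]; exact e)).symm

lemma Ind.zsmul_left {v w : Euc d} (h : Ind v w) {n : ℤ} (hn : n ≠ 0) : Ind (n • v) w := by
  intro a b e
  have := h (a * n) b (by
    rw [← e, ← Int.cast_smul_eq_zsmul ℝ n v, smul_smul]; push_cast; rfl)
  refine ⟨?_, this.2⟩
  have h1 := this.1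
  rcases mul_eq_zero.1 h1 with h | h
  · exact h
  · exact absurd (by exact_mod_cast h) hn

lemma dep {v w : Euc d} (hv : v ≠ 0) (hw : w ≠ 0) (h : ¬ Ind v w) :
    ∃ n m : ℤ, n ≠ 0 ∧ m ≠ 0 ∧ n • v = m • w := by
  unfold Ind at h
  push Not at h
  obtain ⟨a, b, e, hab⟩ := h
  have ha : a ≠ 0 := by
    rintro rfl
    have hb := hab rfl
    simp [hb, hw] at e
  have hb : b ≠ 0 := by
    rintro rfl
    simp [ha, hv] at e
  refine ⟨a.num * b.den, -(b.num * a.den), ?_, ?_, ?_⟩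
  · simp [ha]
  · simp [hb]
  · have e1 : (a.num : ℝ) = a * a.den := by exact_mod_cast (Rat.mul_den_eq_num a).symm
    have e2 : (b.num : ℝ) = b * b.den := by exact_mod_cast (Rat.mul_den_eq_num b).symm
    rw [← Int.cast_smul_eq_zsmul ℝ _ v, ← Int.cast_smul_eq_zsmul ℝ _ w]
    push_cast
    rw [e1, e2]
    have := congrArg (fun x => ((a.den : ℝ) * b.den) • x) e
    simp only [smul_add, smul_smul, smul_zero] at this
    rw [neg_smul, eq_neg_iff_add_eq_zero, ← this]
    congr 2 <;> ring

lemma reduce (T : List (Euc d)) : ∀ (c : Euc d → ℂ), Bdd c → (∀ v ∈ T, v ≠ 0) →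
    T.foldr Delta c = 0 →
    ∃ L : List (Euc d), L.Pairwise Ind ∧
      (∀ v ∈ L, ∃ w ∈ T, ∃ n : ℤ, n ≠ 0 ∧ v = n • w) ∧ L.foldr Delta c = 0 := by
  induction T with
  | nil => intro c _ _ h; exact ⟨[], by simp, by simp, h⟩
  | cons v T ih =>
    intro c hc hT h
    rw [List.foldr_cons, ← foldr_Delta_comm] at h
    obtain ⟨L, hL, hLT, hL0⟩ := ih (Delta v c) (hc.delta v)
      (fun w hw => hT w (List.mem_cons_of_mem _ hw)) h
    by_cases hall : ∀ w ∈ L, Ind v w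
    · refine ⟨v :: L, List.pairwise_cons.2 ⟨hall, hL⟩, ?_, ?_⟩
      · intro x hx
        rcases List.mem_cons.1 hx with rfl | hx
        · exact ⟨x, by simp, 1, one_ne_zero, by simp⟩
        · obtain ⟨w, hw, n, hn, e⟩ := hLT x hx
          exact ⟨w, List.mem_cons_of_mem _ hw, n, hn, e⟩
      · rw [List.foldr_cons, ← foldr_Delta_comm]; exact hL0
    · push Not at hall
      obtain ⟨w, hw, hvw⟩ := hall
      have hw0 : w ≠ 0 := by
        obtain ⟨y, hy, n, hn, rfl⟩ := hLT w hw
        rw [← Int.cast_smul_eq_zsmul ℝ]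
        exact smul_ne_zero (Int.cast_ne_zero.2 hn) (hT y (List.mem_cons_of_mem _ hy))
      obtain ⟨n, m, hn, hm, e⟩ := dep (hT v (by simp)) hw0 hvw
      obtain ⟨L1, hp⟩ : ∃ L1, L.Perm (w :: L1) := by
        classical
        exact ⟨L.erase w, List.perm_cons_erase hw⟩
      have hL' := hL.perm hp (fun h => h.symm)
      rw [List.pairwise_cons] at hL'
      refine ⟨(n • v) :: L1, List.pairwise_cons.2 ⟨?_, hL'.2⟩, ?_, ?_⟩
      · intro x hx
        rw [e]; exact (hL'.1 x hx).zsmul_left hm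
      · intro x hx
        rcases List.mem_cons.1 hx with rfl | hx
        · exact ⟨v, by simp, n, hn, rfl⟩
        · obtain ⟨y, hy, k, hk, e⟩ := hLT x (hp.symm.subset (List.mem_cons_of_mem _ hx))
          exact ⟨y, List.mem_cons_of_mem _ hy, k, hk, e⟩
      · rw [foldr_perm hp, List.foldr_cons, foldr_Delta_comm] at hL0
        rw [List.foldr_cons]
        refine Delta_sq (hc.foldr L1) _ ?_
        have h1 := Delta_zsmul hL0 m
        rw [← e, Delta_comm] at h1
        exact Delta_zsmul h1 n

lemma foldr_cast (L : List (Euc d)) (C : Euc d → ℤ) :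
    L.foldr Delta (fun u => (C u : ℂ)) = fun u =>
      ((act (Euc d) (L.map (fun v => AddMonoidAlgebra.single v (1 : ℤ) - 1)).prod C u : ℤ) : ℂ) := by
  induction L with
  | nil => simp
  | cons v L ih =>
    rw [List.foldr_cons, ih]
    funext u
    simp [Delta, act_single, Module.End.mul_apply, LinearMap.sub_apply]

end deltas

theorem stmt_0 (d : ℕ) (hd : 0 < d) (c : Euc d → ℂ)
    (hfin : (Set.range c).Finite) (hint : ∀ u, ∃ n : ℤ, c u = (n : ℂ))
    (f : Euc d → ℂ) (hfsupp : (Function.support f).Finite)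
    (hfint : ∀ u, ∃ n : ℤ, f u = (n : ℂ)) (hf0 : f ≠ 0)
    (hann : Annihilates f c) :
    ∀ u ∈ Function.support f, ∃ L : List (Euc d),
      L.Pairwise (fun v w => ∀ a b : ℚ, (a : ℝ) • v + (b : ℝ) • w = 0 → a = 0 ∧ b = 0) ∧
      (∀ v ∈ L, ∃ u' ∈ Function.support f, u' ≠ u ∧ ∃ q : ℚ, q ≠ 0 ∧ v = (q : ℝ) • (u' - u)) ∧
      L.foldr Delta c = 0 := by
  intro u hu
  classical
  choose C hC using hint
  choose a ha using hfint
  have hcC : c = fun u => (C u : ℂ) := funext hC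
  have hbd : Bdd c := by
    obtain ⟨M, hM⟩ := (hfin.isBounded).exists_norm_le
    exact ⟨M, fun u => hM _ ⟨u, rfl⟩⟩
  obtain ⟨M, hM⟩ := hbd
  have hMZ : ∀ x, |C x| ≤ ⌈M⌉ := by
    intro x
    have h1 := hM x
    rw [hC x, Complex.norm_intCast] at h1
    have h2 := h1.trans (Int.le_ceil M)
    exact_mod_cast h2
  set S := hfsupp.toFinset with hS
  have h1 : act (Euc d) (fk S a (fun w => w - u) 1) C = 0 := by
    funext x
    rw [act_fk]
    have h2 := hann (x + u)
    rw [conv, finsum_eq_sum_of_support_subset (s := S)] at h2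
    · have h3 : ((∑ w ∈ S, a w * C (x - 1 • (w - u)) : ℤ) : ℂ) = 0 := by
        rw [← h2]; push_cast
        refine Finset.sum_congr rfl fun w _ => ?_
        rw [ha w, hC (x + u - w), one_smul, sub_sub_eq_add_sub]
      exact_mod_cast h3
    · intro w hw
      simp only [hS, Set.Finite.coe_toFinset, Function.mem_support] at hw ⊢
      exact left_ne_zero_of_mul hw
  have ha0 : a u ≠ 0 := by
    intro h0
    exact hu (by rw [ha u, h0]; simp)
  obtain ⟨r, hr, hprod⟩ := prod_ann S a (fun w => w - u) C ⌈M⌉ hMZ h1 u (by simpa [hS] using hu)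
    ha0 (sub_self u)
  set T := (S.erase u).toList.map (fun w => r • (w - u)) with hT
  have hTm : ∀ v ∈ T, ∃ w, w ≠ u ∧ w ∈ Function.support f ∧ v = r • (w - u) := by
    intro v hv
    simp only [hT, List.mem_map, Finset.mem_toList, Finset.mem_erase, hS,
      Set.Finite.mem_toFinset] at hv
    obtain ⟨w, ⟨h1, h2⟩, rfl⟩ := hv
    exact ⟨w, h1, h2, rfl⟩
  have hT0 : T.foldr Delta c = 0 := by
    rw [hcC, foldr_cast, hT, List.map_map]
    have : (List.map ((fun v => AddMonoidAlgebra.single v (1 : ℤ) - 1) ∘ fun w => r • (w - u))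
        (S.erase u).toList).prod
        = ∏ w ∈ S.erase u, (AddMonoidAlgebra.single (r • (w - u)) (1 : ℤ) - 1) :=
      Finset.prod_map_toList _ _
    rw [this, hprod]
    funext x; simp
  obtain ⟨L, hL1, hL2, hL3⟩ := reduce T c ⟨M, hM⟩ (by
    intro v hv
    obtain ⟨w, h1, _, rfl⟩ := hTm v hv
    rw [← Nat.cast_smul_eq_nsmul ℝ]
    exact smul_ne_zero (Nat.cast_ne_zero.2 hr) (sub_ne_zero.2 h1)) hT0
  refine ⟨L, hL1, ?_, hL3⟩
  intro v hv
  obtain ⟨x, hx, n, hn, rfl⟩ := hL2 v hv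
  obtain ⟨w, hwu, hw, rfl⟩ := hTm x hx
  refine ⟨w, hw, hwu, (n : ℚ) * r, ?_, ?_⟩
  · exact mul_ne_zero (by exact_mod_cast hn) (by exact_mod_cast hr)
  · rw [← Int.cast_smul_eq_zsmul ℝ, ← Nat.cast_smul_eq_nsmul ℝ, smul_smul]
    push_cast; rfl

end
end

section
/- (Periodic decomposition theorem for ℝ^d-configurations.) Let d be a positive integer and let c : ℝ^d → ℂ be an integral ℝ^d-configuration (finite range, all values integers) that is annihilated by some non-trivial integral ℝ^d-polynomial. Then there exist finitely many functions c_1, …, c_m : ℝ^d → ℤ, each periodic, such that c = c_1 + … + c_m. -/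
noncomputable section

namespace PD

variable {G : Type*} [AddCommGroup G]

/-- translation operators -/
def shiftHom (G : Type*) [AddCommGroup G] : Multiplicative G →* Module.End ℤ (G → ℤ) where
  toFun v := LinearMap.funLeft ℤ ℤ (fun u => u - v.toAdd)
  map_one' := by ext c u; simp [LinearMap.funLeft_apply]
  map_mul' v w := by
    ext c u
    simp only [LinearMap.funLeft_apply, Module.End.mul_apply, toAdd_mul]
    congr 1; abel

def Phi (G : Type*) [AddCommGroup G] : AddMonoidAlgebra ℤ G →ₐ[ℤ] Module.End ℤ (G → ℤ) :=
  AddMonoidAlgebra.lift ℤ (Module.End ℤ (G → ℤ)) G (shiftHom G)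

lemma Phi_single (v : G) (a : ℤ) (c : G → ℤ) (u : G) :
    Phi G (AddMonoidAlgebra.single v a) c u = a * c (u - v) := by
  simp [Phi, shiftHom, AddMonoidAlgebra.lift_single, LinearMap.funLeft_apply]

/-- f(X^n) -/
def F (S : Finset G) (a : G → ℤ) (n : ℕ) : AddMonoidAlgebra ℤ G :=
  ∑ v ∈ S, AddMonoidAlgebra.single (n • v) (a v)

lemma F_apply (S : Finset G) (a : G → ℤ) (n : ℕ) (c : G → ℤ) (u : G) :
    Phi G (F S a n) c u = ∑ v ∈ S, a v * c (u - n • v) := by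
  simp [F, map_sum, LinearMap.sum_apply, Finset.sum_apply, Phi_single]

lemma F_pow (S : Finset G) (a : G → ℤ) (n p : ℕ) (hp : p.Prime) :
    ∃ g, F S a n ^ p = F S a (n * p) + (p : AddMonoidAlgebra ℤ G) * g := by
  classical
  induction S using Finset.induction_on with
  | empty => exact ⟨0, by simp [F, hp.ne_zero]⟩
  | insert v S hv ih =>
    obtain ⟨g, hg⟩ := ih
    have e : ∀ n, F (insert v S) a n = AddMonoidAlgebra.single (n • v) (a v) + F S a n := by
      intro n; simp [F, Finset.sum_insert hv]
    obtain ⟨r, hr⟩ := exists_add_pow_prime_eq hp (AddMonoidAlgebra.single (n • v) (a v)) (F S a n)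
    have hfermat : (p : ℤ) ∣ a v ^ p - a v := by
      haveI := Fact.mk hp
      rw [← ZMod.intCast_zmod_eq_zero_iff_dvd]
      push_cast
      rw [ZMod.pow_card, sub_self]
    obtain ⟨k, hk⟩ := hfermat
    have hs : (AddMonoidAlgebra.single (n • v) (a v)) ^ p =
        AddMonoidAlgebra.single ((n * p) • v) (a v)
          + (p : AddMonoidAlgebra ℤ G) * AddMonoidAlgebra.single ((n * p) • v) k := by
      rw [AddMonoidAlgebra.single_pow, ← nsmul_eq_mul, AddMonoidAlgebra.smul_single,
        ← AddMonoidAlgebra.single_add, smul_smul, mul_comm p n]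
      congr 1
      rw [nsmul_eq_mul]; linarith
    rw [e, e, hr, hs, hg]
    exact ⟨AddMonoidAlgebra.single ((n * p) • v) k + g
      + AddMonoidAlgebra.single (n • v) (a v) * F S a n * r, by ring⟩

lemma F_step (S : Finset G) (a : G → ℤ) (c : G → ℤ) (M : ℕ) (hM : ∀ u, |c u| ≤ M)
    (n p : ℕ) (hp : p.Prime) (hpB : (∑ v ∈ S, |a v|) * M < p)
    (h : Phi G (F S a n) c = 0) : Phi G (F S a (n * p)) c = 0 := by
  obtain ⟨g, hg⟩ := F_pow S a n p hp
  have h1 : Phi G (F S a n ^ p) c = 0 := by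
    obtain ⟨q, rfl⟩ := Nat.exists_eq_succ_of_ne_zero hp.ne_zero
    rw [pow_succ, map_mul, Module.End.mul_apply, h, map_zero]
  rw [hg] at h1
  funext u
  have h2 := congrFun h1 u
  have h3 : Phi G (F S a (n * p)) c u + p * Phi G g c u = 0 := by
    simpa [map_add, map_mul] using h2
  have hd : (p : ℤ) ∣ Phi G (F S a (n * p)) c u := ⟨- Phi G g c u, by linarith⟩
  apply Int.eq_zero_of_abs_lt_dvd hd
  refine lt_of_le_of_lt ?_ hpB
  rw [F_apply, Finset.sum_mul]
  refine (Finset.abs_sum_le_sum_abs _ _).trans (Finset.sum_le_sum fun v _ => ?_)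
  rw [abs_mul]
  exact mul_le_mul_of_nonneg_left (hM _) (abs_nonneg _)

lemma F_all (S : Finset G) (a : G → ℤ) (c : G → ℤ) (M : ℕ) (hM : ∀ u, |c u| ≤ M)
    (h : Phi G (F S a 1) c = 0) : ∃ r : ℕ, r ≠ 0 ∧ ∀ k, Phi G (F S a (1 + k * r)) c = 0 := by
  obtain ⟨B, hB⟩ : ∃ B : ℕ, (∑ v ∈ S, |a v|) * M = B :=
    Int.eq_ofNat_of_zero_le (mul_nonneg (Finset.sum_nonneg fun _ _ => abs_nonneg _) (by positivity))
  have key : ∀ n : ℕ, n ≠ 0 → (∀ p, p.Prime → p ∣ n → B < p) → Phi G (F S a n) c = 0 := by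
    intro n
    induction n using induction_on_primes with
    | zero => intro h0; exact absurd rfl h0
    | one => intros; exact h
    | prime_mul p n hp ih =>
      intro h0 hh
      rw [mul_comm]
      refine F_step S a c M hM n p hp (by rw [hB]; exact_mod_cast hh p hp (dvd_mul_right _ _)) ?_
      exact ih (right_ne_zero_of_mul h0) fun q hq hd => hh q hq (hd.mul_left p)
  refine ⟨B.factorial, B.factorial_ne_zero, fun k => key _ (by omega) ?_⟩
  intro p hp hd
  by_contra hlt
  have : p ∣ B.factorial := (hp.dvd_factorial).2 (not_lt.1 hlt)
  exact hp.one_lt.ne' (Nat.dvd_one.1 ((Nat.dvd_add_left (this.mul_left k)).1 hd))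

def D (v : G) : AddMonoidAlgebra ℤ G := AddMonoidAlgebra.single v 1 - 1

lemma D_apply (v : G) (c : G → ℤ) (u : G) : Phi G (D v) c u = c (u - v) - c u := by
  simp [D, map_sub, Phi_single]

lemma Phi_mono_cancel (v : G) (a : ℤ) (ha : a ≠ 0) (x : AddMonoidAlgebra ℤ G) (c : G → ℤ)
    (h : Phi G (AddMonoidAlgebra.single v a * x) c = 0) : Phi G x c = 0 := by
  funext u
  have := congrFun h (u + v)
  rw [map_mul, Module.End.mul_apply, Phi_single] at this
  simpa [ha] using this

lemma step1 (htf : ∀ (n : ℤ) (v : G), n • v = 0 → n = 0 ∨ v = 0)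
    (S : Finset G) (a : G → ℤ) (ha : ∀ v ∈ S, a v ≠ 0) (hS : S.Nonempty)
    (c : G → ℤ) (M : ℕ) (hM : ∀ u, |c u| ≤ M)
    (h : Phi G (F S a 1) c = 0) :
    ∃ L : List G, (∀ v ∈ L, v ≠ 0) ∧ Phi G (L.map D).prod c = 0 := by
  classical
  obtain ⟨r, hr, hk⟩ := F_all S a c M hM h
  obtain ⟨v0, hv0⟩ := hS
  let y : G → AddMonoidAlgebra ℤ G := fun v => AddMonoidAlgebra.single (r • v) 1
  let P : Polynomial (AddMonoidAlgebra ℤ G) :=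
    ∏ v ∈ S.erase v0, (Polynomial.X - Polynomial.C (y v))
  have hsum : ∑ v ∈ S, AddMonoidAlgebra.single v (a v) * P.eval (y v) =
      ∑ k ∈ Finset.range (P.natDegree + 1), P.coeff k * F S a (1 + k * r) := by
    simp only [Polynomial.eval_eq_sum_range, F, Finset.mul_sum]
    rw [Finset.sum_comm]
    refine Finset.sum_congr rfl fun k _ => Finset.sum_congr rfl fun v _ => ?_
    have : AddMonoidAlgebra.single ((1 + k * r) • v) (a v) =
        AddMonoidAlgebra.single v (a v) * y v ^ k := by
      simp only [y, AddMonoidAlgebra.single_pow, AddMonoidAlgebra.single_mul_single, one_pow,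
        mul_one, add_smul, one_smul, mul_smul]
    rw [this]; ring
  have h0 : Phi G (∑ v ∈ S, AddMonoidAlgebra.single v (a v) * P.eval (y v)) c = 0 := by
    rw [hsum, map_sum, LinearMap.sum_apply]
    refine Finset.sum_eq_zero fun k _ => ?_
    rw [map_mul, Module.End.mul_apply, hk, map_zero]
  rw [Finset.sum_eq_single_of_mem v0 hv0] at h0
  swap
  · intro v hv hne
    have : P.eval (y v) = 0 := by
      simp only [P, Polynomial.eval_prod]
      exact Finset.prod_eq_zero (Finset.mem_erase.2 ⟨hne, hv⟩) (by simp)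
    rw [this, mul_zero]
  have h1 := Phi_mono_cancel _ _ (ha v0 hv0) _ _ h0
  have h2 : P.eval (y v0) = (∏ v ∈ S.erase v0, y v) * ∏ v ∈ S.erase v0, D (r • (v0 - v)) := by
    simp only [P, Polynomial.eval_prod, ← Finset.prod_mul_distrib]
    refine Finset.prod_congr rfl fun v _ => ?_
    simp only [y, D, mul_sub, AddMonoidAlgebra.single_mul_single, mul_one, ← smul_add]
    simp
  have h3 : ∀ T : Finset G, ∃ w, ∏ v ∈ T, y v = AddMonoidAlgebra.single w 1 := by
    intro T
    induction T using Finset.induction_on with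
    | empty => exact ⟨0, rfl⟩
    | insert v T hv ih =>
      obtain ⟨w, hw⟩ := ih
      exact ⟨r • v + w, by
        rw [Finset.prod_insert hv, hw, AddMonoidAlgebra.single_mul_single, mul_one]⟩
  obtain ⟨w, hw⟩ := h3 (S.erase v0)
  rw [h2, hw] at h1
  have h4 := Phi_mono_cancel _ _ one_ne_zero _ _ h1
  refine ⟨(S.erase v0).toList.map (fun v => r • (v0 - v)), ?_, ?_⟩
  · intro x hx
    simp only [List.mem_map, Finset.mem_toList, Finset.mem_erase] at hx
    obtain ⟨v, ⟨hne, _⟩, rfl⟩ := hx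
    intro h0
    rcases htf r (v0 - v) (by simpa using h0) with h | h
    · exact hr (by exact_mod_cast h)
    · exact hne (sub_eq_zero.1 h).symm
  · rw [List.map_map]
    rw [← Finset.prod_map_toList] at h4
    exact h4

def Inc (v w : G) : Prop := ∀ n m : ℤ, n • v = m • w → n = 0 ∧ m = 0

lemma Inc.symm {v w : G} (h : Inc v w) : Inc w v := fun n m e => (h m n e.symm).symm

lemma not_pairwise {α : Type*} (R : α → α → Prop) (l : List α) (h : ¬ l.Pairwise R) :
    ∃ a b l', l.Perm (a :: b :: l') ∧ ¬ R a b := by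
  induction l with
  | nil => simp at h
  | cons x l ih =>
    by_cases hl : l.Pairwise R
    · rw [List.pairwise_cons] at h
      simp only [hl, and_true, not_forall] at h
      obtain ⟨b, hb, hR⟩ := h
      obtain ⟨s, t, rfl⟩ := List.append_of_mem hb
      exact ⟨x, b, s ++ t, (List.perm_middle).cons x, hR⟩
    · obtain ⟨a, b, l', hp, hR⟩ := ih hl
      refine ⟨a, b, x :: l', (hp.cons x).trans ?_, hR⟩
      exact (List.Perm.swap a x _).trans ((List.Perm.swap b x _).cons a)

def Bdd (c : G → ℤ) : Prop := ∃ M : ℤ, ∀ u, |c u| ≤ M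

lemma Bdd_prod (L : List G) (c : G → ℤ) (hc : Bdd c) : Bdd (Phi G (L.map D).prod c) := by
  induction L with
  | nil => simpa using hc
  | cons v L ih =>
    obtain ⟨M, hM⟩ := ih
    refine ⟨M + M, fun u => ?_⟩
    rw [List.map_cons, List.prod_cons, map_mul, Module.End.mul_apply, D_apply]
    exact (abs_sub _ _).trans (add_le_add (hM _) (hM _))

lemma sq_kill (w : G) (h : G → ℤ) (hb : Bdd h) (h2 : Phi G (D w) (Phi G (D w) h) = 0) :
    Phi G (D w) h = 0 := by
  obtain ⟨M, hM⟩ := hb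
  set e := Phi G (D w) h with he
  have hper : ∀ u, e (u - w) = e u := fun u => by
    have := congrFun h2 u
    rw [D_apply] at this
    exact sub_eq_zero.1 this
  have hn : ∀ (n : ℕ) u, e (u - n • w) = e u := by
    intro n u
    induction n with
    | zero => simp
    | succ n ih => rw [succ_nsmul, ← sub_sub, hper, ih]
  have hlin : ∀ (n : ℕ) u, h (u - n • w) = h u + n * e u := by
    intro n u
    induction n with
    | zero => simp
    | succ n ih =>
      have h1 : e (u - n • w) = h (u - n • w - w) - h (u - n • w) := by rw [he, D_apply]
      rw [hn] at h1
      rw [succ_nsmul, ← sub_sub]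
      push_cast
      linarith
  funext u
  by_contra hne
  have h1 : 1 ≤ |e u| := Int.one_le_abs hne
  have hM0 : 0 ≤ M := (abs_nonneg _).trans (hM u)
  have h3 := hlin (2 * M + 1).toNat u
  have h4 : (((2 * M + 1).toNat : ℕ) : ℤ) = 2 * M + 1 := Int.toNat_of_nonneg (by linarith)
  rw [h4] at h3
  have h5 : |(2 * M + 1) * e u| ≤ M + M := by
    have : (2 * M + 1) * e u = h (u - (2 * M + 1).toNat • w) - h u := by linarith
    rw [this]
    exact (abs_sub _ _).trans (add_le_add (hM _) (hM _))
  rw [abs_mul, abs_of_nonneg (by linarith : (0:ℤ) ≤ 2 * M + 1)] at h5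
  nlinarith

lemma D_dvd (v : G) (n : ℤ) : D v ∣ D (n • v) := by
  have hnat : ∀ (v : G) (n : ℕ), D v ∣ D (n • v) := by
    intro v n
    have : D (n • v) = (AddMonoidAlgebra.single v 1) ^ n - 1 := by
      simp [D, AddMonoidAlgebra.single_pow]
    rw [this]
    exact sub_one_dvd_pow_sub_one _ n
  have hneg : ∀ v : G, D v ∣ D (-v) := by
    intro v
    refine ⟨- AddMonoidAlgebra.single (-v) 1, ?_⟩
    simp [D, sub_mul, AddMonoidAlgebra.single_mul_single, AddMonoidAlgebra.one_def]
  rcases Int.eq_nat_or_neg n with ⟨k, rfl | rfl⟩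
  · simpa using hnat v k
  · have := (hnat v k).trans (hneg (k • v))
    simpa using this

lemma step2 (htf : ∀ (n : ℤ) (v : G), n • v = 0 → n = 0 ∨ v = 0)
    (c : G → ℤ) (hc : Bdd c) (N : ℕ) : ∀ (L : List G), L.length = N → (∀ v ∈ L, v ≠ 0) →
      Phi G (L.map D).prod c = 0 →
    ∃ L : List G, (∀ v ∈ L, v ≠ 0) ∧ L.Pairwise Inc ∧ Phi G (L.map D).prod c = 0 := by
  induction N with
  | zero =>
    intro L hL h0 hk
    obtain rfl := List.length_eq_zero_iff.1 hL
    exact ⟨[], by simp, by simp, hk⟩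
  | succ N ih =>
    intro L hL h0 hk
    by_cases hp : L.Pairwise Inc
    · exact ⟨L, h0, hp, hk⟩
    obtain ⟨a, b, l', hperm, hR⟩ := not_pairwise _ _ hp
    have ha : a ≠ 0 := h0 a (hperm.mem_iff.2 (by simp))
    have hb : b ≠ 0 := h0 b (hperm.mem_iff.2 (by simp))
    have hl' : ∀ v ∈ l', v ≠ 0 := fun v hv => h0 v (hperm.mem_iff.2 (by simp [hv]))
    simp only [Inc, not_forall] at hR
    obtain ⟨n, m, e, hnm⟩ := hR
    have hw : n • a ≠ 0 := by
      intro h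
      have h' := e ▸ h
      exact hnm ⟨(htf _ _ h).resolve_right ha, (htf _ _ h').resolve_right hb⟩
    refine ih (n • a :: l') ?_ ?_ ?_
    · have := hperm.length_eq
      simp at this ⊢
      omega
    · intro v hv
      rcases List.mem_cons.1 hv with rfl | hv
      · exact hw
      · exact hl' v hv
    · rw [List.map_cons, List.prod_cons, map_mul, Module.End.mul_apply]
      apply sq_kill _ _ (Bdd_prod _ _ hc)
      rw [(hperm.map D).prod_eq] at hk
      simp only [List.map_cons, List.prod_cons] at hk
      obtain ⟨x, hx⟩ := D_dvd a n
      obtain ⟨y, hy⟩ := D_dvd b m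
      rw [← e] at hy
      rw [← Module.End.mul_apply, ← map_mul, ← Module.End.mul_apply, ← map_mul]
      have : D (n • a) * D (n • a) * (l'.map D).prod =
          (x * y) * (D a * (D b * (l'.map D).prod)) := by
        nth_rewrite 1 [hx]
        rw [hy]; ring
      rw [this, map_mul, Module.End.mul_apply, hk, map_zero]

lemma solveZ (α : ℤ → ℤ) : ∃ s : ℤ → ℤ, ∀ k, s (k - 1) - s k = α k := by
  refine ⟨fun k => ∑ j ∈ Finset.Ioc k 0, α j - ∑ j ∈ Finset.Ioc 0 k, α j, fun k => ?_⟩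
  rcases le_or_gt k 0 with h | h
  · have h1 : Finset.Ioc (k - 1) 0 = insert k (Finset.Ioc k 0) := by
      ext j; simp only [Finset.mem_Ioc, Finset.mem_insert]; omega
    have h2 : Finset.Ioc 0 k = ∅ := Finset.Ioc_eq_empty_of_le h
    have h3 : Finset.Ioc 0 (k - 1) = ∅ := Finset.Ioc_eq_empty_of_le (by omega)
    simp only [h1, h2, h3]
    rw [Finset.sum_insert (by simp)]
    simp
  · have h1 : Finset.Ioc 0 k = insert k (Finset.Ioc 0 (k - 1)) := by
      ext j; simp only [Finset.mem_Ioc, Finset.mem_insert]; omega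
    have h2 : Finset.Ioc k 0 = ∅ := Finset.Ioc_eq_empty_of_le h.le
    have h3 : Finset.Ioc (k - 1) 0 = ∅ := Finset.Ioc_eq_empty_of_le (by omega)
    simp only [h1, h2, h3]
    rw [Finset.sum_insert (by simp)]
    simp

lemma solve (g : G) (hg : ∀ n : ℤ, n • g = 0 → n = 0) (a : G → ℤ) :
    ∃ b : G → ℤ, ∀ u, b (u - g) - b u = a u := by
  let q : G → G ⧸ AddSubgroup.zmultiples g := QuotientAddGroup.mk
  let rep : G → G := fun u => (q u).out
  have hrep : ∀ u, ∃ k : ℤ, u = rep u + k • g := by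
    intro u
    have : (QuotientAddGroup.mk (rep u) : G ⧸ AddSubgroup.zmultiples g) = QuotientAddGroup.mk u :=
      Quotient.out_eq (q u)
    rw [QuotientAddGroup.eq, AddSubgroup.mem_zmultiples_iff] at this
    obtain ⟨k, hk⟩ := this
    exact ⟨k, by rw [hk]; abel⟩
  choose k hk using hrep
  have hrs : ∀ u, rep (u - g) = rep u := by
    intro u
    have : q (u - g) = q u := by
      simp only [q]
      rw [QuotientAddGroup.eq]
      exact AddSubgroup.mem_zmultiples_iff.2 ⟨1, by simp⟩
    simp only [rep, this]
  have hks : ∀ u, k (u - g) = k u - 1 := by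
    intro u
    have h1 := hk (u - g)
    rw [hrs] at h1
    have h2 := hk u
    have : (k (u - g) - (k u - 1)) • g = 0 := by
      have e1 : k (u - g) • g = u - g - rep u := by
        rw [eq_sub_iff_add_eq, add_comm]; exact h1.symm
      have e2 : k u • g = u - rep u := by
        rw [eq_sub_iff_add_eq, add_comm]; exact h2.symm
      rw [sub_smul, sub_smul, e1, e2, one_smul]; abel
    linarith [hg _ this]
  choose s hs using fun r : G => solveZ (fun j => a (r + j • g))
  refine ⟨fun u => s (rep u) (k u), fun u => ?_⟩
  simp only [hrs, hks, hs]
  rw [← hk u]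

lemma solve_per (g w : G) (h : Inc g w) (a : G → ℤ) (ha : ∀ u, a (u - w) = a u) :
    ∃ b : G → ℤ, (∀ u, b (u - g) - b u = a u) ∧ ∀ u, b (u - w) = b u := by
  have hz : ∀ (n : ℤ) u, a (u + n • w) = a u := by
    intro n
    induction n using Int.induction_on with
    | zero => simp
    | succ n ih =>
      intro u
      rw [← ha, ← ih u]; congr 1; rw [add_smul, one_smul]; abel
    | pred n ih =>
      intro u
      rw [sub_smul, one_smul, ← add_sub_assoc, ha, ih]
  let a' : G ⧸ AddSubgroup.zmultiples w → ℤ := Quotient.lift a (by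
    intro x y hxy
    have hxy' : -x + y ∈ AddSubgroup.zmultiples w := QuotientAddGroup.leftRel_apply.1 hxy
    obtain ⟨n, hn⟩ := AddSubgroup.mem_zmultiples_iff.1 hxy'
    rw [← hz n x, hn]; congr 1; abel)
  obtain ⟨b', hb'⟩ := solve (QuotientAddGroup.mk g : G ⧸ AddSubgroup.zmultiples w) (by
    intro n hn
    have : (QuotientAddGroup.mk (n • g) : G ⧸ AddSubgroup.zmultiples w) = 0 := by
      rw [← hn]; rfl
    rw [QuotientAddGroup.eq_zero_iff, AddSubgroup.mem_zmultiples_iff] at this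
    obtain ⟨m, hm⟩ := this
    exact (h n m hm.symm).1) a'
  refine ⟨fun u => b' (QuotientAddGroup.mk u), fun u => hb' (QuotientAddGroup.mk u), fun u => ?_⟩
  have : (QuotientAddGroup.mk (u - w) : G ⧸ AddSubgroup.zmultiples w) = QuotientAddGroup.mk u := by
    rw [QuotientAddGroup.eq]
    exact AddSubgroup.mem_zmultiples_iff.2 ⟨1, by simp⟩
  simp only [this]

lemma step3 (L : List G) : ∀ (c : G → ℤ), L.Pairwise Inc → Phi G (L.map D).prod c = 0 →
    ∃ cs : Fin L.length → G → ℤ, (∀ i u, cs i (u - L.get i) = cs i u) ∧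
      ∀ u, c u = ∑ i, cs i u := by
  induction L with
  | nil =>
    intro c _ h
    refine ⟨fun i => 0, fun i => i.elim0, fun u => ?_⟩
    have := congrFun h u
    simpa using this
  | cons w L ih =>
    intro c hp h
    rw [List.pairwise_cons] at hp
    rw [List.map_cons, List.prod_cons, mul_comm, map_mul, Module.End.mul_apply] at h
    obtain ⟨as, has, hsum⟩ := ih _ hp.2 h
    have hb : ∀ i : Fin L.length, ∃ b : G → ℤ, (∀ u, b (u - w) - b u = as i u) ∧
        ∀ u, b (u - L.get i) = b u :=
      fun i => solve_per w (L.get i) (hp.1 _ (List.get_mem _ _)) (as i) (has i)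
    choose b hb1 hb2 using hb
    refine ⟨Fin.cons (fun u => c u - ∑ i, b i u) b, ?_, ?_⟩
    · intro i
      refine Fin.cases ?_ ?_ i
      · intro u
        have h1 := hsum u
        rw [D_apply] at h1
        simp only [← hb1, Finset.sum_sub_distrib] at h1
        simp only [List.get_eq_getElem, Fin.val_zero, List.getElem_cons_zero, Fin.cons_zero]
        linarith
      · intro j u
        simpa using hb2 j u
    · intro u
      have : ∀ (x : G → ℤ) , (∑ i : Fin (L.length + 1), (Fin.cons x b : Fin (L.length + 1) → G → ℤ) i u)
          = x u + ∑ i, b i u := by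
        intro x; rw [Fin.sum_univ_succ]; simp
      exact ((this _).trans (by ring)).symm

end PD

theorem stmt_2 (d : ℕ) (hd : 0 < d) (c : Euc d → ℂ)
    (hfin : (Set.range c).Finite) (hint : ∀ u, ∃ n : ℤ, c u = (n : ℂ))
    (f : Euc d → ℂ) (hfsupp : (Function.support f).Finite)
    (hfint : ∀ u, ∃ n : ℤ, f u = (n : ℂ)) (hf0 : f ≠ 0)
    (hann : Annihilates f c) :
    ∃ (m : ℕ) (cs : Fin m → Euc d → ℤ),
      (∀ i, ∃ t : Euc d, t ≠ 0 ∧ ∀ u, cs i (u - t) = cs i u) ∧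
      ∀ u, c u = ∑ i, (cs i u : ℂ) := by
  classical
  choose c' hc' using hint
  choose a ha using hfint
  have htf : ∀ (n : ℤ) (v : Euc d), n • v = 0 → n = 0 ∨ v = 0 := fun n v h => by
    rw [← Int.cast_smul_eq_zsmul ℝ, smul_eq_zero] at h
    exact_mod_cast h
  obtain ⟨M, hM⟩ : ∃ M : ℕ, ∀ u, |c' u| ≤ M := by
    obtain ⟨C, hC⟩ := (hfin.image (fun z => ‖z‖)).bddAbove
    obtain ⟨M, hM⟩ := exists_nat_ge C
    refine ⟨M, fun u => ?_⟩
    have h1 : ‖c u‖ ≤ C := hC ⟨c u, ⟨u, rfl⟩, rfl⟩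
    rw [hc', Complex.norm_intCast] at h1
    exact_mod_cast h1.trans hM
  let S := hfsupp.toFinset
  have haS : ∀ v ∈ S, a v ≠ 0 := by
    intro v hv h0
    have : f v ≠ 0 := by simpa [S] using hv
    exact this (by rw [ha, h0]; simp)
  have hS : S.Nonempty := by
    obtain ⟨v, hv⟩ := Function.ne_iff.1 hf0
    exact ⟨v, by simpa [S] using hv⟩
  have h1 : PD.Phi (Euc d) (PD.F S a 1) c' = 0 := by
    funext u
    rw [PD.F_apply]
    have := hann u
    rw [conv, finsum_eq_sum_of_support_subset (s := S)] at this
    · simp only [ha, hc'] at this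
      simp only [one_smul, Pi.zero_apply]
      exact_mod_cast this
    · intro v hv
      have : f v ≠ 0 := left_ne_zero_of_mul hv
      simpa [S] using this
  obtain ⟨L, hL0, hL⟩ := PD.step1 htf S a haS hS c' M hM h1
  obtain ⟨L, hL0, hLp, hL⟩ := PD.step2 htf c' ⟨M, hM⟩ _ L rfl hL0 hL
  obtain ⟨cs, h2, h3⟩ := PD.step3 L c' hLp hL
  refine ⟨L.length, cs, fun i => ⟨L.get i, hL0 _ (List.get_mem _ _), h2 i⟩, fun u => ?_⟩
  rw [hc', h3]
  push_cast
  rfl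

end
end

section
/- Let c : ℝ → ℂ be an integral 1-dimensional Delone configuration, i.e., c has finite range, all its values are integers, and its support {u : c(u) ≠ 0} is a Delone set in ℝ. If c is annihilated by some non-trivial integral ℝ-polynomial, then c is periodic. -/
/- STATEMENT 3: A 1-dimensional integral Delone configuration with a non-trivial
   integral annihilator is periodic. -/

noncomputable section

def conv1 (f c : ℝ → ℂ) (u : ℝ) : ℂ := ∑ᶠ v, f v * c (u - v)

def Annihilates1 (f c : ℝ → ℂ) : Prop := ∀ u, conv1 f c u = 0

def UniformlyDiscrete1 (S : Set ℝ) : Prop :=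
  ∃ r > (0:ℝ), ∀ x : ℝ, (S ∩ Metric.ball x r).Subsingleton

def RelativelyDense1 (S : Set ℝ) : Prop :=
  ∃ R > (0:ℝ), ∀ x : ℝ, (S ∩ Metric.closedBall x R).Nonempty

def IsDelone1 (S : Set ℝ) : Prop := UniformlyDiscrete1 S ∧ RelativelyDense1 S

open Filter

def AnnF (F : Finset ℝ) (f g : ℝ → ℂ) : Prop := ∀ u, ∑ v ∈ F, f v * g (u - v) = 0

lemma det_right (F : Finset ℝ) (f : ℝ → ℂ) (hF : F.Nonempty) (hf : ∀ v ∈ F, f v ≠ 0) :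
    ∃ L0 : ℝ, ∀ L ≥ L0, ∀ g, AnnF F f g → ∀ a, (∀ x ∈ Set.Icc a (a + L), g x = 0) →
      ∀ x, a ≤ x → g x = 0 := by
  set v0 := F.min' hF with hv0
  have hv0F : v0 ∈ F := F.min'_mem hF
  obtain ⟨δ, hδ, hδF⟩ : ∃ δ > (0:ℝ), ∀ v ∈ F, v ≠ v0 → δ ≤ v - v0 := by
    by_cases he : (F.erase v0).Nonempty
    · refine ⟨(F.erase v0).min' he - v0, ?_, ?_⟩
      · have h1 := (F.erase v0).min'_mem he
        rw [Finset.mem_erase] at h1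
        have h2 := F.min'_le _ h1.2
        have := lt_of_le_of_ne h2 (Ne.symm h1.1)
        exact sub_pos.2 this
      · intro v hv hne
        have := (F.erase v0).min'_le v (Finset.mem_erase.2 ⟨hne, hv⟩)
        linarith
    · refine ⟨1, one_pos, fun v hv hne => (he ⟨v, Finset.mem_erase.2 ⟨hne, hv⟩⟩).elim⟩
  refine ⟨F.max' hF - v0, fun L hL g hg a ha => ?_⟩
  have key : ∀ n : ℕ, ∀ x, a ≤ x → x ≤ a + L + n * δ → g x = 0 := by
    intro n
    induction n with
    | zero => intro x h1 h2; exact ha x ⟨h1, by simpa using h2⟩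
    | succ n ih =>
      intro x h1 h2
      push_cast at h2
      by_cases hx : x ≤ a + L
      · exact ha x ⟨h1, hx⟩
      push Not at hx
      have := hg (x + v0)
      rw [Finset.sum_eq_single v0] at this
      · simpa [hf v0 hv0F] using this
      · intro v hv hne
        rw [ih (x + v0 - v), mul_zero]
        · have := F.le_max' v hv
          linarith
        · have := hδF v hv hne
          linarith
      · intro h; exact (h hv0F).elim
  intro x hx
  obtain ⟨n, hn⟩ := exists_nat_ge ((x - a - L) / δ)
  rw [div_le_iff₀ hδ] at hn
  exact key n x hx (by linarith)

lemma det_both (F : Finset ℝ) (f : ℝ → ℂ) (hF : F.Nonempty) (hf : ∀ v ∈ F, f v ≠ 0) :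
    ∃ L > (0:ℝ), ∀ g, AnnF F f g → ∀ a, (∀ x ∈ Set.Icc a (a + L), g x = 0) →
      ∀ x, g x = 0 := by
  obtain ⟨L1, h1⟩ := det_right F f hF hf
  obtain ⟨L2, h2⟩ := det_right (F.image Neg.neg) (fun v => f (-v)) (hF.image _) (by
    intro v hv
    rw [Finset.mem_image] at hv
    obtain ⟨w, hw, rfl⟩ := hv
    simpa using hf w hw)
  refine ⟨max 1 (max L1 L2), by positivity, fun g hg a ha x => ?_⟩
  rcases le_total a x with hx | hx
  · exact h1 _ (by simp) g hg a ha x hx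
  · have := h2 (max 1 (max L1 L2)) (by simp) (fun x => g (-x)) ?_ (-(a + max 1 (max L1 L2))) ?_ (-x) ?_
    · simpa using this
    · intro u
      rw [Finset.sum_image (by intro p _ q _ h; exact neg_injective h)]
      rw [← hg (-u)]
      refine Finset.sum_congr rfl fun v _ => ?_
      simp only [neg_neg]
      congr 2; ring
    · intro y hy
      apply ha
      constructor <;> linarith [hy.1, hy.2]
    · have : 0 < max 1 (max L1 L2) := by positivity
      linarith

noncomputable abbrev UU : Ultrafilter ℕ := hyperfilter ℕ

lemma ulim_exists (c : ℝ → ℂ) (hfin : (Set.range c).Finite) (x : ℕ → ℝ) :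
    ∃ g : ℝ → ℂ, ∀ u, ∀ᶠ k in (UU : Filter ℕ), c (x k + u) = g u := by
  have : ∀ u, ∃ z, ∀ᶠ k in (UU : Filter ℕ), c (x k + u) = z := by
    intro u
    have h : (⋃ z ∈ Set.range c, {k | c (x k + u) = z}) ∈ UU := by
      have : (⋃ z ∈ Set.range c, {k | c (x k + u) = z}) = Set.univ := by
        ext k; simp
      rw [this]
      exact Filter.univ_mem
    rw [Ultrafilter.finite_biUnion_mem_iff hfin] at h
    obtain ⟨z, _, hz⟩ := h
    exact ⟨z, hz⟩
  choose g hg using this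
  exact ⟨g, hg⟩

/-- g is the limit of c along x -/
def IsLim (c : ℝ → ℂ) (x : ℕ → ℝ) (g : ℝ → ℂ) : Prop :=
  ∀ u, ∀ᶠ k in (UU : Filter ℕ), c (x k + u) = g u

/-- at most N support points in each window of length L -/
def Cnt (L : ℝ) (N : ℕ) (c : ℝ → ℂ) : Prop :=
  ∀ a, ∀ T : Finset ℝ, (∀ t ∈ T, c t ≠ 0 ∧ t ∈ Set.Icc a (a + L)) → T.card ≤ N

def USep (r : ℝ) (c : ℝ → ℂ) : Prop := ∀ p q, c p ≠ 0 → c q ≠ 0 → |p - q| < r → p = q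

def Eqv (y z : ℕ → ℝ) : Prop := ∃ d, ∀ᶠ k in (UU : Filter ℕ), y k - z k = d

def Comp (c : ℝ → ℂ) (x y : ℕ → ℝ) : Prop :=
  (∀ᶠ k in (UU : Filter ℕ), c (y k) ≠ 0) ∧ ∃ B, ∀ᶠ k in (UU : Filter ℕ), |y k - x k| ≤ B

lemma not_eqv {y z : ℕ → ℝ} (h : ¬ Eqv y z) (d : ℝ) : ∀ᶠ k in (UU : Filter ℕ), y k - z k ≠ d := by
  have : ¬ ∀ᶠ k in (UU : Filter ℕ), y k - z k = d := fun h' => h ⟨d, h'⟩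
  exact Ultrafilter.eventually_not.2 this

lemma Eqv.symm {y z : ℕ → ℝ} (h : Eqv y z) : Eqv z y := by
  obtain ⟨d, hd⟩ := h
  exact ⟨-d, hd.mono fun k hk => by linarith⟩

lemma Eqv.trans {x y z : ℕ → ℝ} (h : Eqv x y) (h' : Eqv y z) : Eqv x z := by
  obtain ⟨d, hd⟩ := h
  obtain ⟨e, he⟩ := h'
  exact ⟨d + e, by filter_upwards [hd, he] with k h1 h2; linarith⟩

lemma Comp.st {c : ℝ → ℂ} {x y : ℕ → ℝ} (h : Comp c x y) :
    ∃ s, ∀ ε > 0, ∀ᶠ k in (UU : Filter ℕ), |y k - x k - s| < ε := by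
  obtain ⟨B, hB⟩ := h.2
  have hc : IsCompact (Set.Icc (-B) B) := isCompact_Icc
  obtain ⟨s, _, hs⟩ := hc.ultrafilter_le_nhds (UU.map fun k => y k - x k) (by
    rw [le_principal_iff]
    exact hB.mono fun k hk => abs_le.1 hk)
  refine ⟨s, fun ε hε => ?_⟩
  have : Tendsto (fun k => y k - x k) UU (nhds s) := hs
  have := (Metric.tendsto_nhds.1 this) ε hε
  exact this

lemma IsLim.ann {F : Finset ℝ} {f c g : ℝ → ℂ} {x : ℕ → ℝ} (h : IsLim c x g) (hc : AnnF F f c) :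
    AnnF F f g := by
  intro u
  have : ∀ᶠ k in (UU : Filter ℕ), ∀ v ∈ F, c (x k + (u - v)) = g (u - v) := by
    rw [Filter.eventually_all_finset]
    intro v _
    exact h _
  obtain ⟨k, hk⟩ := this.exists
  rw [← hc (x k + u)]
  refine Finset.sum_congr rfl fun v hv => ?_
  rw [← hk v hv]
  congr 2; ring

lemma IsLim.sep {r : ℝ} {c g : ℝ → ℂ} {x : ℕ → ℝ} (h : IsLim c x g) (hc : USep r c) :
    USep r g := by
  intro p q hp hq hpq
  obtain ⟨k, h1, h2⟩ := ((h p).and (h q)).exists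
  have := hc (x k + p) (x k + q) (by rwa [h1]) (by rwa [h2]) (by simpa using hpq)
  linarith

lemma IsLim.fin {c g : ℝ → ℂ} {x : ℕ → ℝ} (h : IsLim c x g) (hc : (Set.range c).Finite) :
    (Set.range g).Finite := by
  refine hc.subset ?_
  rintro _ ⟨u, rfl⟩
  obtain ⟨k, hk⟩ := (h u).exists
  exact ⟨_, hk⟩

lemma IsLim.ne {c g : ℝ → ℂ} {x : ℕ → ℝ} (h : IsLim c x g)
    (hx : ∀ᶠ k in (UU : Filter ℕ), c (x k) ≠ 0) : g 0 ≠ 0 := by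
  obtain ⟨k, hk, h2⟩ := ((h 0).and hx).exists
  rw [← hk]; simpa using h2

lemma count {L : ℝ} {N : ℕ} {c : ℝ → ℂ} (hN : Cnt L N c) (x : ℕ → ℝ) (a : ℝ)
    (Z : Finset (ℕ → ℝ))
    (h1 : ∀ z ∈ Z, ∀ᶠ k in (UU : Filter ℕ), c (z k) ≠ 0 ∧ z k ∈ Set.Icc (x k + a) (x k + a + L))
    (h2 : ∀ z ∈ Z, ∀ z' ∈ Z, z ≠ z' → ∀ᶠ k in (UU : Filter ℕ), z k ≠ z' k) : Z.card ≤ N := by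
  have e1 : ∀ᶠ k in (UU : Filter ℕ), ∀ z ∈ Z, c (z k) ≠ 0 ∧ z k ∈ Set.Icc (x k + a) (x k + a + L) := by
    rw [Filter.eventually_all_finset]; exact h1
  have e2 : ∀ᶠ k in (UU : Filter ℕ), ∀ z ∈ Z, ∀ z' ∈ Z, z ≠ z' → z k ≠ z' k := by
    rw [Filter.eventually_all_finset]; intro z hz
    rw [Filter.eventually_all_finset]; intro z' hz'
    by_cases h : z = z'
    · simp [h]
    · exact (h2 z hz z' hz' h).mono fun k hk _ => hk
  obtain ⟨k, k1, k2⟩ := (e1.and e2).exists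
  rw [← Finset.card_image_of_injOn (f := fun z : ℕ → ℝ => z k) (s := Z)]
  · apply hN (x k + a)
    intro t ht
    rw [Finset.mem_image] at ht
    obtain ⟨z, hz, rfl⟩ := ht
    exact k1 z hz
  · intro z hz z' hz' h
    by_contra hne
    exact k2 z hz z' hz' hne h

/-- determinism with windows of length L -/
def Det (F : Finset ℝ) (f : ℝ → ℂ) (L : ℝ) : Prop :=
  ∀ g, AnnF F f g → ∀ a, (∀ x ∈ Set.Icc a (a + L), g x = 0) → ∀ x, g x = 0

/-- each companion class has a point in the window -/
lemma Comp.point {F : Finset ℝ} {f c : ℝ → ℂ} {L : ℝ} (hdet : Det F f L) (hc : AnnF F f c)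
    (hfin : (Set.range c).Finite)
    {x y : ℕ → ℝ} (h : Comp c x y) (a : ℝ) :
    ∃ v, ∀ᶠ k in (UU : Filter ℕ), c (y k + v) ≠ 0 ∧
      y k + v ∈ Set.Icc (x k + a) (x k + a + (L + 1)) := by
  obtain ⟨s, hs⟩ := h.st
  obtain ⟨g, hg⟩ := ulim_exists c hfin y
  have hg' : IsLim c y g := hg
  have : ∃ v ∈ Set.Icc (a - s + 1/2) (a - s + 1/2 + L), g v ≠ 0 := by
    by_contra hcon
    push Not at hcon
    exact hg'.ne h.1 (hdet g (hg'.ann hc) _ hcon 0)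
  obtain ⟨v, hv, hgv⟩ := this
  refine ⟨v, ?_⟩
  filter_upwards [hg v, hs (1/2) (by norm_num)] with k h1 h2
  rw [abs_lt] at h2
  refine ⟨by rwa [h1], ?_, ?_⟩ <;> linarith [hv.1, hv.2, h2.1, h2.2]

lemma decrease {F : Finset ℝ} {f c : ℝ → ℂ} {L : ℝ} (hdet : Det F f L) (hc : AnnF F f c)
    (hfin : (Set.range c).Finite) {N : ℕ} (hN : Cnt (L + 1) (N + 1) c)
    {x y : ℕ → ℝ} {g : ℝ → ℂ} (hg : IsLim c x g) (h : Comp c x y) (hne : ¬ Eqv y x) :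
    Cnt (L + 1) N g := by
  classical
  intro a T hT
  obtain ⟨v, hv⟩ := h.point hdet hc hfin a
  have hinj : Function.Injective (fun (t : ℝ) (k : ℕ) => x k + t) := by
    intro t t' htt
    have := congrFun htt 0
    simpa using this
  have hyx : ∀ t, ∀ᶠ k in (UU : Filter ℕ), y k + v ≠ x k + t := by
    intro t
    filter_upwards [not_eqv hne (t - v)] with k hk hk'
    apply hk; linarith
  set Z1 := T.image (fun (t : ℝ) (k : ℕ) => x k + t) with hZ1
  have hnot : (fun k => y k + v) ∉ Z1 := by
    intro hmem
    rw [hZ1, Finset.mem_image] at hmem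
    obtain ⟨t, _, ht⟩ := hmem
    obtain ⟨k, hk⟩ := (hyx t).exists
    exact hk (congrFun ht k).symm
  have hcard : (insert (fun k => y k + v) Z1).card = T.card + 1 := by
    rw [Finset.card_insert_of_notMem hnot, Finset.card_image_of_injective _ hinj]
  have := count hN x a (insert (fun k => y k + v) Z1) ?_ ?_
  · omega
  · intro z hz
    rw [Finset.mem_insert, Finset.mem_image] at hz
    rcases hz with rfl | ⟨t, ht, rfl⟩
    · exact hv
    · filter_upwards [hg t] with k hk
      have := hT t ht
      exact ⟨by rw [hk]; exact this.1, by constructor <;> linarith [this.2.1, this.2.2]⟩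
  · intro z hz z' hz' hzz
    rw [Finset.mem_insert, Finset.mem_image] at hz hz'
    rcases hz with rfl | ⟨t, ht, rfl⟩ <;> rcases hz' with rfl | ⟨t', ht', rfl⟩
    · exact (hzz rfl).elim
    · exact hyx t'
    · exact (hyx t).mono fun k hk => hk.symm
    · refine Eventually.of_forall fun k hk => hzz ?_
      have : t = t' := by simpa using hk
      rw [this]

lemma classes {F : Finset ℝ} {f c : ℝ → ℂ} {L : ℝ} (hdet : Det F f L) (hc : AnnF F f c)
    (hfin : (Set.range c).Finite) {N : ℕ} (hN : Cnt (L + 1) N c) (x : ℕ → ℝ) :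
    ∃ Y : Finset (ℕ → ℝ), (∀ y ∈ Y, Comp c x y) ∧ ∀ y, Comp c x y → ∃ z ∈ Y, Eqv y z := by
  classical
  let P : ℕ → Prop := fun m => ∃ Y : Finset (ℕ → ℝ), Y.card = m ∧ (∀ y ∈ Y, Comp c x y) ∧
    ∀ y ∈ Y, ∀ z ∈ Y, y ≠ z → ¬ Eqv y z
  have hb : ∀ m, P m → m ≤ N := by
    rintro m ⟨Y, rfl, hY, hY2⟩
    have : ∀ y : ℕ → ℝ, ∃ v, y ∈ Y → ∀ᶠ k in (UU : Filter ℕ), c (y k + v) ≠ 0 ∧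
      y k + v ∈ Set.Icc (x k + 0) (x k + 0 + (L + 1)) := by
      intro y
      by_cases hy : y ∈ Y
      · obtain ⟨v, hv⟩ := (hY y hy).point hdet hc hfin 0
        exact ⟨v, fun _ => hv⟩
      · exact ⟨0, fun h => (hy h).elim⟩
    choose v hv using this
    have hd : ∀ y ∈ Y, ∀ z ∈ Y, y ≠ z → ∀ᶠ k in (UU : Filter ℕ), y k + v y ≠ z k + v z := by
      intro y hy z hz hyz
      filter_upwards [not_eqv (hY2 y hy z hz hyz) (v z - v y)] with k hk hk'
      apply hk; linarith
    rw [← Finset.card_image_of_injOn (f := fun (y : ℕ → ℝ) (k : ℕ) => y k + v y) (s := Y)]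
    · apply count hN x 0
      · intro z hz
        rw [Finset.mem_image] at hz
        obtain ⟨y, hy, rfl⟩ := hz
        exact hv y hy
      · intro z hz z' hz' hne
        rw [Finset.mem_image] at hz hz'
        obtain ⟨y, hy, rfl⟩ := hz
        obtain ⟨y', hy', rfl⟩ := hz'
        exact hd y hy y' hy' (by rintro rfl; exact hne rfl)
    · intro y hy z hz h
      by_contra hne
      obtain ⟨k, hk⟩ := (hd y hy z hz hne).exists
      exact hk (congrFun h k)
  have h0 : P 0 := ⟨∅, by simp⟩
  have hmax : P (Nat.findGreatest P N) := Nat.findGreatest_spec (Nat.zero_le N) h0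
  obtain ⟨Y, hcard, hY, hY2⟩ := hmax
  refine ⟨Y, hY, fun y hy => ?_⟩
  by_contra hcon
  push Not at hcon
  have hyY : y ∉ Y := fun h => hcon y h ⟨0, by simp⟩
  have hP : P (Nat.findGreatest P N + 1) := by
    refine ⟨insert y Y, by rw [Finset.card_insert_of_notMem hyY, hcard], ?_, ?_⟩
    · intro z hz
      rcases Finset.mem_insert.1 hz with rfl | hz
      · exact hy
      · exact hY z hz
    · intro z hz z' hz' hne
      rcases Finset.mem_insert.1 hz with e | hz1 <;> rcases Finset.mem_insert.1 hz' with e' | hz2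
      · exact (hne (e.trans e'.symm)).elim
      · rw [e]; exact hcon z' hz2
      · rw [e']; exact fun h => hcon z hz1 h.symm
      · exact hY2 z hz1 z' hz2 hne
  have := Nat.le_findGreatest (hb _ hP) hP
  omega

lemma zper {g : ℝ → ℂ} {w : ℝ} (h : ∀ u, g (u + w) = g u) (n : ℤ) (u : ℝ) :
    g (u + n * w) = g u := by
  have : Function.Periodic g w := h
  exact this.int_mul n u

lemma commens {c g h : ℝ → ℂ} {r : ℝ} (hr : 0 < r) (hsep : USep r c) {x y : ℕ → ℝ}
    (hy : Comp c x y) (hx : ∀ᶠ k in (UU : Filter ℕ), c (x k) ≠ 0) (hne : ¬ Eqv y x)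
    (hg : IsLim c y g) (hh : IsLim c x h) {w w' : ℝ} (hw : w ≠ 0) (hw' : w' ≠ 0)
    (pg : ∀ u, g (u + w) = g u) (ph : ∀ u, h (u + w') = h u) :
    ∃ n : ℤ, n ≠ 0 ∧ ∀ u, g (u + n * w') = g u := by
  by_cases hirr : Irrational (w / w')
  · exfalso
    obtain ⟨s, hs⟩ := hy.st
    have hd := (dense_addSubgroupClosure_pair_iff (a := w) (b := w')).2 hirr
    obtain ⟨p, hp, hps⟩ := hd.exists_dist_lt (-s) (half_pos hr)
    have hp' : p ∈ AddSubgroup.closure {w, w'} := hp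
    rw [AddSubgroup.mem_closure_pair] at hp'
    obtain ⟨m, n, rfl⟩ := hp'
    simp only [zsmul_eq_mul] at hps
    have g0 : g (0 + m * w) ≠ 0 := by rw [zper pg]; exact hg.ne hy.1
    have h0 : h (0 + (-n : ℤ) * w') ≠ 0 := by rw [zper ph]; exact hh.ne hx
    obtain ⟨k, k1, k2, k3, k4⟩ := ((hg (0 + m * w)).and ((hh (0 + (-n : ℤ) * w')).and
      ((hs (r/2) (half_pos hr)).and (not_eqv hne (-(m * w + n * w')))))).exists
    rw [← k1] at g0
    rw [← k2] at h0
    apply k4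
    have := hsep _ _ g0 h0 ?_
    · push_cast at this; linarith
    · rw [Real.dist_eq] at hps
      rw [abs_lt] at *
      push_cast
      constructor <;> linarith [hps.1, hps.2, k3.1, k3.2]
  · unfold Irrational at hirr
    push Not at hirr
    obtain ⟨q, hq⟩ := hirr
    have hq0 : q ≠ 0 := by
      rintro rfl
      rw [Rat.cast_zero] at hq
      exact div_ne_zero hw hw' hq.symm
    refine ⟨q.num, Rat.num_ne_zero.2 hq0, fun u => ?_⟩
    have : (q.num : ℝ) * w' = (q.den : ℤ) * w := by
      have hden : (q.den : ℝ) ≠ 0 := by exact_mod_cast q.den_ne_zero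
      rw [Rat.cast_def] at hq
      field_simp at hq
      push_cast
      linarith
    rw [this, zper pg]

/-- period on window gives global period -/
lemma per_of_window {F : Finset ℝ} {f c : ℝ → ℂ} {L : ℝ} (hdet : Det F f L) (hc : AnnF F f c)
    (a w : ℝ) (h : ∀ u ∈ Set.Icc 0 L, c (a + u + w) = c (a + u)) : ∀ u, c (u + w) = c u := by
  have := hdet (fun u => c (u + w) - c u) ?_ a ?_
  · intro u; exact sub_eq_zero.1 (this u)
  · intro u
    simp only [mul_sub, Finset.sum_sub_distrib]
    rw [hc u, sub_zero, ← hc (u + w)]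
    refine Finset.sum_congr rfl fun v _ => ?_
    congr 2; ring
  · intro u hu
    have := h (u - a) ⟨by linarith [hu.1], by linarith [hu.2]⟩
    simp only [add_sub_cancel] at this
    exact sub_eq_zero.2 this

lemma main_ind {F : Finset ℝ} {f : ℝ → ℂ} {L r : ℝ} (hL : 0 < L) (hr : 0 < r) (hdet : Det F f L)
    (N : ℕ) : ∀ c : ℝ → ℂ, (Set.range c).Finite → AnnF F f c → USep r c → Cnt (L + 1) N c →
      ∃ t : ℝ, t ≠ 0 ∧ ∀ u, c (u + t) = c u := by
  classical
  induction N with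
  | zero =>
    intro c _ _ _ hN
    have : ∀ u, c u = 0 := by
      intro u
      by_contra hu
      have := hN u {u} (by
        intro t ht
        rw [Finset.mem_singleton] at ht
        subst ht
        exact ⟨hu, le_rfl, by linarith⟩)
      simp at this
    exact ⟨1, one_ne_zero, fun u => by rw [this, this]⟩
  | succ N ih =>
    intro c hfin hc hsep hN
    by_cases hz : ∀ u, c u = 0
    · exact ⟨1, one_ne_zero, fun u => by rw [hz, hz]⟩
    have hx : ∀ k : ℕ, ∃ x ∈ Set.Icc (k * (2 * L)) (k * (2 * L) + L), c x ≠ 0 := by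
      intro k
      by_contra hcon
      push Not at hcon
      exact hz (hdet c hc _ hcon)
    choose x hxI hxc using hx
    have hxinj : ∀ k l : ℕ, k < l → x k < x l := by
      intro k l hkl
      have h1 := (hxI k).2
      have h2 := (hxI l).1
      have : (k : ℝ) + 1 ≤ l := by exact_mod_cast hkl
      nlinarith
    have hxx : Comp c x x := ⟨Eventually.of_forall hxc, 0, by simp⟩
    obtain ⟨h, hh⟩ : ∃ h, IsLim c x h := ulim_exists c hfin x
    by_cases hA : ∀ y, Comp c x y → Eqv y x
    · -- a single class
      have hev : ∀ᶠ k in (UU : Filter ℕ), ∀ u ∈ Set.Icc 0 L, c (x k + u) = h u := by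
        by_contra hcon
        have hcon := Ultrafilter.eventually_not.2 hcon
        have : ∀ k, ∃ u, u ∈ Set.Icc 0 L ∧ ((¬ ∀ u ∈ Set.Icc 0 L, c (x k + u) = h u) →
            c (x k + u) ≠ h u) := by
          intro k
          by_cases hk : ∀ u ∈ Set.Icc 0 L, c (x k + u) = h u
          · exact ⟨0, ⟨le_rfl, hL.le⟩, fun h => (h hk).elim⟩
          · have hk' := hk
            push Not at hk'
            obtain ⟨u, hu, hu2⟩ := hk'
            exact ⟨u, hu, fun _ => hu2⟩
        choose u hu hu2 using this
        have hne : ∀ᶠ k in (UU : Filter ℕ), c (x k + u k) ≠ h (u k) :=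
          hcon.mono fun k hk => hu2 k hk
        -- it suffices that u is eventually constant
        have hconst : ∀ d, ¬ ∀ᶠ k in (UU : Filter ℕ), u k = d := by
          intro d hd
          obtain ⟨k, k1, k2, k3⟩ := (hd.and (hne.and (hh d))).exists
          rw [k1] at k2
          exact k2 k3
        by_cases hcz : ∀ᶠ k in (UU : Filter ℕ), c (x k + u k) ≠ 0
        · obtain ⟨d, hd⟩ := hA (fun k => x k + u k) ⟨hcz, L, Eventually.of_forall fun k => by
            simp only [add_sub_cancel_left]
            rw [abs_of_nonneg (hu k).1]; exact (hu k).2⟩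
          exact hconst d (hd.mono fun k hk => by linarith)
        · have hcz := Ultrafilter.eventually_not.2 hcz
          have hfinS : {t | h t ≠ 0 ∧ t ∈ Set.Icc 0 L}.Finite := by
            by_contra hinf
            obtain ⟨T, hT, hTc⟩ := Set.Infinite.exists_subset_card_eq hinf (N + 2)
            have := count hN x 0 (T.image (fun (t : ℝ) (k : ℕ) => x k + t)) ?_ ?_
            · rw [Finset.card_image_of_injective, hTc] at this
              · omega
              · intro t t' htt
                simpa using congrFun htt 0
            · intro z hz
              rw [Finset.mem_image] at hz
              obtain ⟨t, ht, rfl⟩ := hz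
              have := hT ht
              filter_upwards [hh t] with k hk
              exact ⟨by rw [hk]; exact this.1, by constructor <;> linarith [this.2.1, this.2.2]⟩
            · intro z hz z' hz' hzz
              rw [Finset.mem_image] at hz hz'
              obtain ⟨t, ht, rfl⟩ := hz
              obtain ⟨t', ht', rfl⟩ := hz'
              refine Eventually.of_forall fun k hk => hzz ?_
              have : t = t' := by simpa using hk
              rw [this]
          have hmem : (⋃ t ∈ {t | h t ≠ 0 ∧ t ∈ Set.Icc 0 L}, {k | u k = t}) ∈ UU := by
            filter_upwards [hcz, hne] with k h1 h2
            simp only [Set.mem_iUnion]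
            refine ⟨u k, ⟨?_, hu k⟩, rfl⟩
            rw [not_not] at h1
            rw [h1] at h2
            exact h2.symm
          rw [Ultrafilter.finite_biUnion_mem_iff hfinS] at hmem
          obtain ⟨d, _, hd⟩ := hmem
          exact hconst d hd
      obtain ⟨k, hk⟩ := hev.exists
      have hne : ∀ᶠ l in (UU : Filter ℕ), l ≠ k := by
        have : ({k}ᶜ : Set ℕ) ∈ hyperfilter ℕ := (Set.finite_singleton k).compl_mem_hyperfilter
        exact this
      obtain ⟨l, hl, hlk⟩ := (hev.and hne).exists
      refine ⟨x l - x k, ?_, ?_⟩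
      · rcases lt_or_gt_of_ne hlk with h | h
        · exact (sub_neg.2 (hxinj _ _ h)).ne
        · exact (sub_pos.2 (hxinj _ _ h)).ne'
      · apply per_of_window hdet hc (x k)
        intro u hu
        rw [hk u hu, ← hl u hu]
        congr 1; ring
    · push Not at hA
      obtain ⟨y1, hy1, hy1x⟩ := hA
      have compTrans : ∀ y z, Comp c x y → Comp c x z → Comp c y z := by
        rintro y z ⟨_, B, hB⟩ ⟨hz, B', hB'⟩
        refine ⟨hz, B' + B, ?_⟩
        filter_upwards [hB, hB'] with k h1 h2
        rw [abs_le] at *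
        constructor <;> linarith [h1.1, h1.2, h2.1, h2.2]
      have hper : ∀ y, Comp c x y → ∀ g, IsLim c y g → ∃ t : ℝ, t ≠ 0 ∧ ∀ u, g (u + t) = g u := by
        intro y hy g hg
        apply ih g (hg.fin hfin) (hg.ann hc) (hg.sep hsep)
        by_cases hyx : Eqv x y
        · exact decrease hdet hc hfin hN hg (compTrans y y1 hy hy1) (fun h => hy1x (h.trans hyx.symm))
        · exact decrease hdet hc hfin hN hg (compTrans y x hy hxx) hyx
      obtain ⟨w', hw', ph⟩ := hper x hxx h hh
      have hcom : ∀ y, ∃ n : ℤ, n ≠ 0 ∧ (Comp c x y →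
          ∀ g, IsLim c y g → ∀ u, g (u + n * w') = g u) := by
        intro y
        by_cases hy : Comp c x y
        swap
        · exact ⟨1, one_ne_zero, fun h => (hy h).elim⟩
        have huniq : ∀ g g', IsLim c y g → IsLim c y g' → g = g' := by
          intro g g' h1 h2
          funext u
          obtain ⟨k, k1, k2⟩ := ((h1 u).and (h2 u)).exists
          rw [← k1, k2]
        obtain ⟨g, hg⟩ : ∃ g, IsLim c y g := ulim_exists c hfin y
        suffices hs : ∃ n : ℤ, n ≠ 0 ∧ ∀ u, g (u + n * w') = g u by
          obtain ⟨n, hn, hn2⟩ := hs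
          exact ⟨n, hn, fun _ g' hg' => huniq g g' hg hg' ▸ hn2⟩
        by_cases hyx : Eqv y x
        · refine ⟨1, one_ne_zero, fun u => ?_⟩
          obtain ⟨d, hd⟩ := hyx
          obtain ⟨k, k1, k2, k3, k4, k5⟩ := (hd.and ((hg (u + (1:ℤ) * w')).and ((hg u).and
            ((hh (d + u + w')).and (hh (d + u)))))).exists
          rw [← k2, ← k3]
          have e1 : y k + (u + (1:ℤ) * w') = x k + (d + u + w') := by push_cast; linarith
          have e2 : y k + u = x k + (d + u) := by linarith
          rw [e1, e2, k4, k5, ph]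
        · obtain ⟨w, hw, pg⟩ := hper y hy g hg
          exact commens hr hsep hy hxx.1 hyx hg hh hw hw' pg ph
      choose n hn hn2 using hcom
      obtain ⟨Y, hY, hY2⟩ := classes hdet hc hfin hN x
      set M : ℤ := ∏ y ∈ Y, n y with hM
      have hM0 : M ≠ 0 := Finset.prod_ne_zero_iff.2 fun y _ => hn y
      have hW : (M : ℝ) * w' ≠ 0 := mul_ne_zero (by exact_mod_cast hM0) hw'
      -- c is locally M w' periodic at any companion
      have hloc : ∀ y, Comp c x y → ∀ m : ℤ,
          ∀ᶠ k in (UU : Filter ℕ), c (y k + m * (M * w')) = c (y k) := by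
        intro y hy m
        obtain ⟨z, hz, d, hd⟩ := hY2 y hy
        obtain ⟨g, hg⟩ : ∃ g, IsLim c z g := ulim_exists c hfin z
        have hp := hn2 z (hY z hz) g hg
        obtain ⟨q, hq⟩ := Finset.dvd_prod_of_mem n hz
        rw [← hM] at hq
        filter_upwards [hd, hg d, hg (d + (m * q : ℤ) * (n z * w'))] with k k1 k2 k3
        rw [zper hp, ← k2] at k3
        have e1 : y k = z k + d := by linarith
        rw [e1, ← k3, hq]
        congr 1; push_cast; ring
      refine ⟨M * w', hW, ?_⟩
      have hev : ∀ᶠ k in (UU : Filter ℕ),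
          ∀ u ∈ Set.Icc 0 L, c (x k + u + M * w') = c (x k + u) := by
        by_contra hcon
        have hcon := Ultrafilter.eventually_not.2 hcon
        have : ∀ k, ∃ u, u ∈ Set.Icc 0 L ∧
            ((¬ ∀ u ∈ Set.Icc 0 L, c (x k + u + M * w') = c (x k + u)) →
            c (x k + u + M * w') ≠ c (x k + u)) := by
          intro k
          by_cases hk : ∀ u ∈ Set.Icc 0 L, c (x k + u + M * w') = c (x k + u)
          · exact ⟨0, ⟨le_rfl, hL.le⟩, fun h => (h hk).elim⟩
          · have hk' := hk
            push Not at hk'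
            obtain ⟨u, hu, hu2⟩ := hk'
            exact ⟨u, hu, fun _ => hu2⟩
        choose u hu hu2 using this
        have hne : ∀ᶠ k in (UU : Filter ℕ), c (x k + u k + M * w') ≠ c (x k + u k) :=
          hcon.mono fun k hk => hu2 k hk
        by_cases hcz : ∀ᶠ k in (UU : Filter ℕ), c (x k + u k) ≠ 0
        · have := hloc (fun k => x k + u k) ⟨hcz, L, Eventually.of_forall fun k => by
            simp only [add_sub_cancel_left]
            rw [abs_of_nonneg (hu k).1]; exact (hu k).2⟩ 1
          obtain ⟨k, k1, k2⟩ := (this.and hne).exists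
          apply k2
          simpa using k1
        · have hcz := Ultrafilter.eventually_not.2 hcz
          have hc2 : ∀ᶠ k in (UU : Filter ℕ), c (x k + u k + M * w') ≠ 0 := by
            filter_upwards [hcz, hne] with k h1 h2 h3
            rw [not_not] at h1
            exact h2 (h3.trans h1.symm)
          have := hloc (fun k => x k + u k + M * w') ⟨hc2, L + |M * w'|, Eventually.of_forall fun k => by
            have : x k + u k + M * w' - x k = u k + M * w' := by ring
            rw [this]
            refine (abs_add_le _ _).trans ?_
            rw [abs_of_nonneg (hu k).1]; linarith [(hu k).2]⟩ (-1)
          obtain ⟨k, k1, k2⟩ := (this.and hne).exists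
          apply k2
          rw [← k1]
          congr 1; push_cast; ring
      obtain ⟨k, hk⟩ := hev.exists
      exact per_of_window hdet hc (x k) _ hk

lemma cnt_of_sep {c : ℝ → ℂ} {r : ℝ} (hr : 0 < r) (hsep : USep r c) (L : ℝ) :
    ∃ N, Cnt L N c := by
  refine ⟨⌊L / r⌋₊ + 1, fun a T hT => ?_⟩
  have : T.card ≤ (Finset.range (⌊L / r⌋₊ + 1)).card := by
    apply Finset.card_le_card_of_injOn (fun t => ⌊(t - a) / r⌋₊)
    · intro t ht
      have := (hT t ht).2
      simp only [Finset.coe_range, Set.mem_Iio]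
      apply Nat.lt_succ_of_le
      apply Nat.floor_le_floor
      apply div_le_div_of_nonneg_right _ hr.le
      linarith [this.2]
    · intro t ht t' ht' h
      simp only at h
      have h1 := hT t ht
      have h2 := hT t' ht'
      apply hsep t t' h1.1 h2.1
      have p1 : 0 ≤ (t - a) / r := div_nonneg (by linarith [h1.2.1]) hr.le
      have p2 : 0 ≤ (t' - a) / r := div_nonneg (by linarith [h2.2.1]) hr.le
      have a1 := Nat.floor_le p1
      have a2 := Nat.lt_floor_add_one ((t - a) / r)
      have b1 := Nat.floor_le p2
      have b2 := Nat.lt_floor_add_one ((t' - a) / r)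
      rw [h] at a1 a2
      have : |(t - a) / r - (t' - a) / r| < 1 := by rw [abs_lt]; constructor <;> linarith
      have e : (t - a) / r - (t' - a) / r = (t - t') / r := by ring
      rw [e, abs_div, abs_of_pos hr, div_lt_one hr] at this
      exact this
  simpa using this

theorem stmt_3 (c : ℝ → ℂ)
    (hfin : (Set.range c).Finite) (hint : ∀ u, ∃ n : ℤ, c u = (n : ℂ))
    (hsupp : IsDelone1 (Function.support c))
    (f : ℝ → ℂ) (hfsupp : (Function.support f).Finite)
    (hfint : ∀ u, ∃ n : ℤ, f u = (n : ℂ)) (hf0 : f ≠ 0)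
    (hann : Annihilates1 f c) :
    ∃ t : ℝ, t ≠ 0 ∧ ∀ u, c (u - t) = c u := by
  obtain ⟨⟨r, hr, hud⟩, -⟩ := hsupp
  set F := hfsupp.toFinset with hF
  have hne : F.Nonempty := by
    obtain ⟨v, hv⟩ := Function.ne_iff.1 hf0
    exact ⟨v, by simpa [hF] using hv⟩
  have hf : ∀ v ∈ F, f v ≠ 0 := by
    intro v hv
    simpa [hF] using hv
  have hc : AnnF F f c := by
    intro u
    rw [← hann u]
    unfold conv1
    rw [finsum_eq_sum_of_support_subset]
    intro v hv
    simp only [Function.mem_support] at hv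
    have : f v ≠ 0 := left_ne_zero_of_mul hv
    simpa [hF] using this
  have hsep : USep r c := by
    intro p q hp hq hpq
    apply hud q
    · exact ⟨hp, by simpa [Real.dist_eq] using hpq⟩
    · exact ⟨hq, by simpa using hr⟩
  obtain ⟨L, hL, hdet⟩ := det_both F f hne hf
  obtain ⟨N, hN⟩ := cnt_of_sep hr hsep (L + 1)
  obtain ⟨t, ht, hper⟩ := main_ind hL hr hdet N c hfin hc hsep hN
  refine ⟨t, ht, fun u => ?_⟩
  have := hper (u - t)
  rw [sub_add_cancel] at this
  exact this.symm

end
end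

section
/- Let d be a positive integer, let S ⊆ ℝ^d be a Meyer set, and let R > 0 be such that every closed ball of radius R contains a point of S. Let U = (S + S − S) ∩ B_R(0) and, for T ≥ 0, let H_T = U ∪ (S ∩ B_T(0)) (where B_T(0) is the closed ball of radius T at the origin). If liminf_{T→∞} N_S(T)/T^d = 0, then there exists T ≥ 0 such that S has low complexity with respect to H_T, i.e., P_S(H_T) ≤ |H_T|. -/
/- STATEMENT 6: A Meyer set with patch-counting function satisfying
   liminf N_S(T)/T^d = 0 has low complexity with respect to H_T = U ∪ (S ∩ B_T)
   for some T. -/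

open scoped Pointwise

noncomputable section

def UniformlyDiscrete {d : ℕ} (S : Set (Euc d)) : Prop :=
  ∃ r > (0:ℝ), ∀ x : Euc d, (S ∩ Metric.ball x r).Subsingleton

def RelativelyDense {d : ℕ} (S : Set (Euc d)) : Prop :=
  ∃ R > (0:ℝ), ∀ x : Euc d, (S ∩ Metric.closedBall x R).Nonempty

def IsDelone {d : ℕ} (S : Set (Euc d)) : Prop := UniformlyDiscrete S ∧ RelativelyDense S

def IsMeyer {d : ℕ} (S : Set (Euc d)) : Prop := IsDelone S ∧ IsDelone (S - S)

/-- The set of `T`-patches of `S` translated to the origin. -/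
def patches {d : ℕ} (S : Set (Euc d)) (T : ℝ) : Set (Set (Euc d)) :=
  {P | ∃ s ∈ S, P = (fun x => x - s) '' (S ∩ Metric.closedBall s T)}

/-- The set of `D`-patterns of `S` translated to the origin. -/
def patternSet {d : ℕ} (S D : Set (Euc d)) : Set (Set (Euc d)) :=
  {P | ∃ t : Euc d, P = ((fun x => x - t) '' S) ∩ D}


lemma aux_walk {E : Type*} [AddCommGroup E] (V F : Set E) (G : SimpleGraph V)
    (hG : ∀ x y : V, G.Adj x y → (y : E) - x ∈ F) (v w : V) (p : G.Walk v w) :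
    (w : E) - v ∈ p.length • F := by
  induction p with
  | nil => simp
  | cons h p ih =>
    rename_i u v w
    rw [SimpleGraph.Walk.length_cons, succ_nsmul]
    refine Set.mem_add.2 ⟨_, ih, _, hG _ _ h, by abel⟩

lemma aux_nsmul_finite {E : Type*} [AddCommGroup E] {F : Set E} (hF : F.Finite) (n : ℕ) :
    (n • F).Finite := by
  induction n with
  | zero => simp
  | succ n ih => rw [succ_nsmul]; exact ih.add hF

lemma aux_chain {E : Type*} [AddCommGroup E] (V F : Set E) (hV : V.Finite) (h0 : (0 : E) ∈ F)
    (hneg : ∀ x ∈ F, -x ∈ F) (M : ℕ) (hM : V.ncard ≤ M) (v w : V)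
    (h : Relation.ReflTransGen (fun x y : V => (y : E) - x ∈ F) v w) :
    (w : E) - v ∈ M • F := by
  classical
  let G : SimpleGraph V := 
    { Adj := fun x y => x ≠ y ∧ (y : E) - x ∈ F
      symm := ⟨fun x y h => ⟨h.1.symm, by have := hneg _ h.2; simpa using this⟩⟩
      loopless := ⟨fun x h => h.1 rfl⟩ }
  have hr : G.Reachable v w := by
    induction h with
    | refl => exact SimpleGraph.Reachable.refl _
    | tail _ h ih =>
      rename_i b c _
      by_cases hbc : b = c
      · exact hbc ▸ ih
      · exact ih.trans (SimpleGraph.Adj.reachable (G := G) ⟨hbc, h⟩)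
  obtain ⟨p, hp⟩ := hr.exists_isPath
  have : Fintype V := hV.fintype
  have h1 := hp.length_lt
  rw [← Nat.card_eq_fintype_card, Nat.card_coe_set_eq] at h1
  have h2 := aux_walk V F G (fun x y h => h.2) v w p
  exact Set.nsmul_subset_nsmul_right h0 (by omega) h2

lemma aux_count {d : ℕ} (L : Set (Euc d)) (hL : UniformlyDiscrete L) (ρ : ℝ) :
    ∃ M : ℕ, ∀ x : Euc d, (L ∩ Metric.closedBall x ρ).Finite ∧
      (L ∩ Metric.closedBall x ρ).ncard ≤ M := by
  obtain ⟨r, hr, h⟩ := hL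
  obtain ⟨t, -, htf, ht⟩ := (isCompact_closedBall (0 : Euc d) ρ).finite_cover_balls hr
  refine ⟨t.ncard, fun x => ?_⟩
  have : ∀ z ∈ L ∩ Metric.closedBall x ρ, ∃ y ∈ t, z - x ∈ Metric.ball y r := by
    intro z hz
    have : z - x ∈ Metric.closedBall (0 : Euc d) ρ := by
      have := hz.2
      rw [mem_closedBall_iff_norm] at this
      simpa using this
    simpa using ht this
  choose! f hf1 hf2 using this
  have hinj : Set.InjOn f (L ∩ Metric.closedBall x ρ) := by
    intro z hz z' hz' e
    refine h (f z + x) ⟨hz.1, ?_⟩ ⟨hz'.1, ?_⟩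
    · have := hf2 z hz
      rw [mem_ball_iff_norm] at this ⊢
      rwa [← sub_sub, sub_right_comm]
    · have := hf2 z' hz'
      rw [e]
      rw [mem_ball_iff_norm] at this ⊢
      rwa [← sub_sub, sub_right_comm]
  exact ⟨Set.Finite.of_injOn hf1 hinj htf, Set.ncard_le_ncard_of_injOn f hf1 hinj htf⟩

lemma aux_locfin {d : ℕ} (S : Set (Euc d)) (hL : UniformlyDiscrete (S - S))
    (R : ℝ) (hR : 0 < R) (hRdense : ∀ x : Euc d, (S ∩ Metric.closedBall x R).Nonempty) (ρ : ℝ) 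
    (hρ : 0 ≤ ρ) :
    (((S - S) - (S - S)) ∩ Metric.closedBall 0 ρ).Finite := by
  choose n hn using hRdense
  have hnS : ∀ x, n x ∈ S := fun x => (hn x).1
  have hnR : ∀ x, ‖n x - x‖ ≤ R := fun x => mem_closedBall_iff_norm.1 (hn x).2
  obtain ⟨M, hM⟩ := aux_count (S - S) hL (2 * R + ρ)
  obtain ⟨_, hK⟩ := aux_count (S - S) hL (2 * R + 1 + ρ)
  set K := (S - S) ∩ Metric.closedBall 0 (2 * R + 1 + ρ) with hKdef
  have hKf : K.Finite := (hK 0).1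
  have hKm : ∀ x ∈ S, ∀ y ∈ S, ‖x - y‖ ≤ 2 * R + 1 + ρ → x - y ∈ K := fun x hx y hy h =>
    ⟨Set.sub_mem_sub hx hy, by simpa using h⟩
  have h0 : (0 : Euc d) ∈ K - K := by
    have h : (0:Euc d) ∈ K := by
      have := hKm (n 0) (hnS 0) (n 0) (hnS 0) (by simp; positivity)
      simpa using this
    exact ⟨0, h, 0, h, by simp⟩
  have hneg : ∀ x ∈ K - K, -x ∈ K - K := by
    rintro _ ⟨x, hx, y, hy, rfl⟩
    exact ⟨y, hy, x, hx, by simp⟩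
  refine (aux_nsmul_finite (hKf.sub hKf) M).subset ?_
  rintro _ ⟨⟨_, ⟨a, ha, b, hb, rfl⟩, _, ⟨c, hc, e, he, rfl⟩, rfl⟩, hz⟩
  -- swap roles: start at `c - e`, end at `a - b`
  have hz : ‖(a - b) - (c - e)‖ ≤ ρ := by simpa using hz
  set w := c - e with hw
  set V := (S - S) ∩ Metric.closedBall w (2 * R + ρ) with hV
  let f : Euc d → V := fun p => ⟨n (p + w) - n p, Set.sub_mem_sub (hnS _) (hnS _), by
    rw [mem_closedBall_iff_norm]
    have h1 := hnR (p + w)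
    have h2 := hnR p
    have : n (p + w) - n p - w = (n (p + w) - (p + w)) - (n p - p) := by abel
    rw [this]
    have := norm_sub_le (n (p + w) - (p + w)) (n p - p)
    linarith⟩
  have hcV : c - e ∈ V := ⟨Set.sub_mem_sub hc he, by
    rw [mem_closedBall_iff_norm]; simp [hw]; positivity⟩
  have haV : a - b ∈ V := ⟨Set.sub_mem_sub ha hb, by
    rw [mem_closedBall_iff_norm]; linarith⟩
  have step : ∀ p q, ‖q - p‖ ≤ 1 → ((f q : V) : Euc d) - f p ∈ K - K := by
    intro p q hpq
    refine ⟨n (q + w) - n (p + w), hKm _ (hnS _) _ (hnS _) ?_, n q - n p, 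
      hKm _ (hnS _) _ (hnS _) ?_, by simp only [f]; abel⟩
    · have : n (q + w) - n (p + w) = (n (q + w) - (q + w)) - (n (p + w) - (p + w)) + (q - p) := by
        abel
      rw [this]
      have h1 := norm_add_le ((n (q + w) - (q + w)) - (n (p + w) - (p + w))) (q - p)
      have h2 := norm_sub_le (n (q + w) - (q + w)) (n (p + w) - (p + w))
      linarith [hnR (q + w), hnR (p + w)]
    · have : n q - n p = (n q - q) - (n p - p) + (q - p) := by
        abel
      rw [this]
      have h1 := norm_add_le ((n q - q) - (n p - p)) (q - p)
      have h2 := norm_sub_le (n q - q) (n p - p)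
      linarith [hnR q, hnR p]
  let r : V → V → Prop := fun x y => (y : Euc d) - x ∈ K - K
  have hfirst : r ⟨c - e, hcV⟩ (f e) := by
    refine ⟨n (e + w) - c, hKm _ (hnS _) _ hc ?_, n e - e, hKm _ (hnS _) _ he ?_, ?_⟩
    · have := hnR (e + w)
      have h2 : e + w = c := by simp [hw]
      rw [h2] at this ⊢
      linarith
    · linarith [hnR e]
    · simp only [f]; abel
  have hlast : r (f b) ⟨a - b, haV⟩ := by
    refine ⟨a - n (b + w), hKm _ ha _ (hnS _) ?_, b - n b, hKm _ hb _ (hnS _) ?_, ?_⟩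
    · have : a - n (b + w) = ((a - b) - w) - (n (b + w) - (b + w)) := by abel
      rw [this]
      have h2 := norm_sub_le ((a - b) - w) (n (b + w) - (b + w))
      linarith [hnR (b + w)]
    · rw [norm_sub_rev]
      linarith [hnR b]
    · simp only [f]; abel
  obtain ⟨m, hm⟩ := exists_nat_gt ‖b - e‖
  have hm0 : (0:ℝ) < m := lt_of_le_of_lt (norm_nonneg _) hm
  set v := (m : ℝ)⁻¹ • (b - e) with hv
  have hv1 : ‖v‖ ≤ 1 := by
    rw [hv, norm_smul, norm_inv, Real.norm_natCast, inv_mul_le_iff₀ hm0]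
    linarith
  have hmid : ∀ i : ℕ, Relation.ReflTransGen r (f e) (f (e + (i : ℝ) • v)) := by
    intro i
    induction i with
    | zero => simp only [Nat.cast_zero, zero_smul, add_zero]; exact .refl
    | succ i ih =>
      refine ih.tail (step _ _ ?_)
      have : e + ((i + 1 : ℕ) : ℝ) • v - (e + (i : ℝ) • v) = v := by
        push_cast; module
      rw [this]; exact hv1
  have hend : e + (m : ℝ) • v = b := by
    rw [hv, smul_smul, mul_inv_cancel₀ hm0.ne']; simp
  have hm' := hmid m
  rw [hend] at hm'
  exact aux_chain V (K - K) (hM w).1 h0 hneg M (hM w).2 ⟨c - e, hcV⟩ ⟨a - b, haV⟩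
    (((Relation.ReflTransGen.single hfirst).trans hm').tail hlast)

open MeasureTheory in
lemma aux_volume {d : ℕ} (S : Set (Euc d)) 
    (R : ℝ) (hR : 0 < R) (hRdense : ∀ x : Euc d, (S ∩ Metric.closedBall x R).Nonempty) (T : ℝ)
    (hT : R ≤ T) (hf : (S ∩ Metric.closedBall 0 T).Finite) : 
    (T - R) ^ d ≤ ((S ∩ Metric.closedBall 0 T).ncard : ℝ) * R ^ d := by
  have hcov : Metric.closedBall (0 : Euc d) (T - R) ⊆
      ⋃ s ∈ hf.toFinset, Metric.closedBall s R := by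
    intro x hx
    obtain ⟨s, hs, hsx⟩ := hRdense x
    rw [Set.mem_iUnion₂]
    refine ⟨s, ?_, by rwa [Metric.mem_closedBall_comm]⟩
    rw [Set.Finite.mem_toFinset]
    refine ⟨hs, ?_⟩
    rw [Metric.mem_closedBall] at *
    have := dist_triangle s x 0
    linarith
  have h1 := (measure_mono hcov).trans
    (measure_biUnion_finset_le (μ := (volume : Measure (Euc d))) hf.toFinset
      (fun s => Metric.closedBall s R))
  simp only [Measure.addHaar_closedBall volume _ (sub_nonneg.2 hT), 
    Measure.addHaar_closedBall volume _ hR.le, finrank_euclideanSpace, Fintype.card_fin,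
    Finset.sum_const, nsmul_eq_mul, ← mul_assoc] at h1
  rw [ENNReal.mul_le_mul_iff_left (Metric.measure_ball_pos _ _ one_pos).ne' 
    measure_ball_lt_top.ne] at h1
  rw [← Set.ncard_eq_toFinset_card _ hf, ← ENNReal.ofReal_natCast, 
    ← ENNReal.ofReal_mul (by positivity)] at h1
  exact (ENNReal.ofReal_le_ofReal_iff (by positivity)).1 h1

theorem stmt_6 (d : ℕ) (hd : 0 < d) (S : Set (Euc d)) (hS : IsMeyer S)
    (R : ℝ) (hR : 0 < R) (hRdense : ∀ x : Euc d, (S ∩ Metric.closedBall x R).Nonempty)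
    (U : Set (Euc d)) (hU : U = (S + S - S) ∩ Metric.closedBall 0 R)
    (HT : ℝ → Set (Euc d)) (hHT : ∀ T, HT T = U ∪ (S ∩ Metric.closedBall 0 T))
    (hliminf : Filter.liminf
      (fun T : ℝ => ((patches S T).encard : ℕ∞) / ENNReal.ofReal (T ^ d))
      Filter.atTop = 0) :
    ∃ T : ℝ, 0 ≤ T ∧ (patternSet S (HT T)).encard ≤ (HT T).encard := by
  obtain ⟨s0, hs0, -⟩ := hRdense 0
  have hUf : U.Finite := by
    have h := aux_locfin S hS.2.1 R hR hRdense (R + ‖s0‖) (by positivity)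
    refine (h.image (fun x => x + s0)).subset ?_
    rw [hU]
    rintro _ ⟨⟨_, ⟨a, ha, b, hb, rfl⟩, c, hc, rfl⟩, hx⟩
    have hx : ‖a + b - c‖ ≤ R := by simpa using hx
    refine ⟨(a - c) - (s0 - b), ⟨⟨_, ⟨a, ha, c, hc, rfl⟩, _, ⟨s0, hs0, b, hb, rfl⟩, rfl⟩, ?_⟩, ?_⟩
    · rw [mem_closedBall_zero_iff]
      have : (a - c) - (s0 - b) = (a + b - c) - s0 := by abel
      rw [this]
      exact (norm_sub_le _ _).trans (by linarith)
    · simp only; abel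
  set ε : ℝ := 1 / ((1 + U.ncard) * (2 * R) ^ d) with hε
  have hεpos : 0 < ε := by positivity
  have hfreq := Filter.frequently_lt_of_liminf_lt (f := Filter.atTop)
    (u := fun T : ℝ => ((patches S T).encard : ENNReal) / ENNReal.ofReal (T ^ d))
    (b := ENNReal.ofReal ε) (h := by rw [hliminf]; exact ENNReal.ofReal_pos.2 hεpos)
  obtain ⟨T', hlt, hT'⟩ := (hfreq.and_eventually (Filter.eventually_ge_atTop (4 * R))).exists
  have hT'pos : 0 < T' := by linarith
  have hNfin : (patches S T').Finite := by
    rw [← Set.encard_ne_top_iff]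
    intro h
    rw [h] at hlt
    simp [ENNReal.top_div] at hlt
  have hN : ((patches S T').ncard : ℝ) ≤ ε * T' ^ d := by
    rw [← hNfin.cast_ncard_eq] at hlt
    have h2 := hlt.le
    rw [ENNReal.div_le_iff (by simp; positivity) (by simp), 
      ← ENNReal.ofReal_mul hεpos.le] at h2
    rw [← ENNReal.ofReal_le_ofReal_iff (by positivity)]
    simpa using h2
  have hN1 : 1 ≤ (patches S T').ncard := by
    exact (Set.ncard_pos hNfin).2 ⟨_, s0, hs0, rfl⟩
  refine ⟨T' - R, by linarith, ?_⟩
  set T := T' - R with hT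
  -- counting patterns
  have hsub : patternSet S (HT T) ⊆ insert ∅ 
      ((fun q : Euc d × Set (Euc d) => ((fun x => x + q.1) '' q.2) ∩ HT T) '' 
        (U ×ˢ patches S T')) := by
    rintro _ ⟨t, rfl⟩
    rcases Set.eq_empty_or_nonempty ((fun x => x - t) '' S ∩ HT T) with h | h
    · rw [h]; exact Set.mem_insert _ _
    right
    obtain ⟨s, hs, hu⟩ : ∃ s ∈ S, s - t ∈ U := by
      obtain ⟨_, ⟨y, hy, rfl⟩, hx⟩ := h
      rw [hHT] at hx
      rcases hx with hx | hx
      · exact ⟨y, hy, hx⟩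
      · obtain ⟨s, hs, hst⟩ := hRdense t
        refine ⟨s, hs, ?_⟩
        rw [hU]
        refine ⟨⟨_, ⟨s, hs, _, hx.1, rfl⟩, y, hy, by simp only; abel⟩, ?_⟩
        rw [mem_closedBall_iff_norm] at hst
        simpa using hst
    refine ⟨(s - t, _), ⟨hu, s, hs, rfl⟩, ?_⟩
    have huR : ‖s - t‖ ≤ R := by rw [hU] at hu; simpa using hu.2
    ext x
    simp only [Set.mem_inter_iff, Set.mem_image]
    refine and_congr_left fun hx => ?_
    have hxT : ‖x‖ ≤ T := by
      rw [hHT] at hx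
      rcases hx with hx | hx
      · rw [hU] at hx
        have : ‖x‖ ≤ R := by simpa using hx.2
        linarith
      · simpa using hx.2
    constructor
    · rintro ⟨_, ⟨y, hy, rfl⟩, rfl⟩
      exact ⟨y, hy.1, by abel⟩
    · rintro ⟨y, hy, rfl⟩
      refine ⟨y - s, ⟨y, ⟨hy, ?_⟩, rfl⟩, by abel⟩
      rw [mem_closedBall_iff_norm]
      have : y - s = (y - t) - (s - t) := by abel
      rw [this]
      exact (norm_sub_le _ _).trans (by linarith)
  have hcard : (patternSet S (HT T)).encard ≤ ((U.ncard * (patches S T').ncard + 1 : ℕ) : ℕ∞) := by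
    have hf : (U ×ˢ patches S T').Finite := hUf.prod hNfin
    refine (Set.encard_le_encard hsub).trans ((Set.encard_insert_le _ _).trans ?_)
    push_cast
    gcongr
    refine (Set.encard_image_le _ _).trans ?_
    rw [← hf.cast_ncard_eq, Set.ncard_prod]
    push_cast; rfl
  refine hcard.trans ?_
  have hle : (S ∩ Metric.closedBall 0 T).encard ≤ (HT T).encard := by
    apply Set.encard_le_encard
    rw [hHT]; exact Set.subset_union_right
  refine le_trans ?_ hle
  by_cases hfin : (S ∩ Metric.closedBall (0 : Euc d) T).Finite
  swap
  · rw [Set.Infinite.encard_eq hfin]; exact le_top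
  rw [← hfin.cast_ncard_eq, Nat.cast_le]
  have hv := aux_volume S R hR hRdense T (by linarith) hfin
  have h3 : (T' / 2) ^ d ≤ (T - R) ^ d := by
    apply pow_le_pow_left₀ (by positivity); linarith
  have h4 : (1 + (U.ncard : ℝ)) * (patches S T').ncard * R ^ d ≤ (T' / 2) ^ d := by
    calc (1 + (U.ncard : ℝ)) * (patches S T').ncard * R ^ d 
        ≤ (1 + (U.ncard : ℝ)) * (ε * T' ^ d) * R ^ d := by gcongr
      _ = (T' / 2) ^ d := by
        rw [hε, mul_pow, div_pow]; field_simp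
  have h5 := le_of_mul_le_mul_right ((h4.trans h3).trans hv) (by positivity)
  have h6 : (1 + U.ncard) * (patches S T').ncard ≤ (S ∩ Metric.closedBall 0 T).ncard := by
    exact_mod_cast h5
  nlinarith

end
end
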